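/- arXiv:2311.15953 — 9 statements merged into one kernel-verified Lean document; each statement's English description precedes it below -/
import Mathlib

section
/- Let (A, M) be a finite set system and let H = (A, M) be the associated hypergraph. Then the Rawlsian justice value p_R(A, M) equals 1 / k_f^≥(H), where k_f^≥(H) is the fractional covering number of H. -/
open Finset

/-- Uniform fairness value `p_U` of a set system `(A, M)`. -/
noncomputable def pU {α : Type*} [DecidableEq α] (A : Finset α) (M : Finset (Finset α)) : ℝ :=
  sSup {p : ℝ | ∃ x : Finset α → ℝ, (∀ m ∈ M, 0 ≤ x m) ∧ (∑ m ∈ M, x m) = 1 ∧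
    ∀ a ∈ A, (∑ m ∈ M.filter (fun m => a ∈ m), x m) = p}

/-- Rawlsian justice value `p_R` of a set system `(A, M)`. -/
noncomputable def pR {α : Type*} [DecidableEq α] (A : Finset α) (M : Finset (Finset α)) : ℝ :=
  sSup {p : ℝ | ∃ x : Finset α → ℝ, (∀ m ∈ M, 0 ≤ x m) ∧ (∑ m ∈ M, x m) = 1 ∧
    ∀ a ∈ A, p ≤ (∑ m ∈ M.filter (fun m => a ∈ m), x m)}

/-- Fractional partitioning number `k_f^=` of the hypergraph `(A, M)`. -/
noncomputable def fracPartNum {α : Type*} [DecidableEq α] (A : Finset α) (M : Finset (Finset α)) : ℝ :=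
  sInf {s : ℝ | ∃ w : Finset α → ℝ, (∀ m ∈ M, 0 ≤ w m) ∧
    (∀ a ∈ A, (∑ m ∈ M.filter (fun m => a ∈ m), w m) = 1) ∧ s = ∑ m ∈ M, w m}

/-- Fractional covering number `k_f^≥` of the hypergraph `(A, M)`. -/
noncomputable def fracCovNum {α : Type*} [DecidableEq α] (A : Finset α) (M : Finset (Finset α)) : ℝ :=
  sInf {s : ℝ | ∃ w : Finset α → ℝ, (∀ m ∈ M, 0 ≤ w m) ∧
    (∀ a ∈ A, 1 ≤ (∑ m ∈ M.filter (fun m => a ∈ m), w m)) ∧ s = ∑ m ∈ M, w m}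

/-- If the incidence sum of a nonnegative weight at some point is at least `1`, so is its
total weight. -/
lemma one_le_sum_of_one_le_sum_filter {α : Type*} [DecidableEq α] {M : Finset (Finset α)}
    {w : Finset α → ℝ} {a : α} (hw : ∀ m ∈ M, 0 ≤ w m)
    (ha : 1 ≤ ∑ m ∈ M.filter (fun m => a ∈ m), w m) : 1 ≤ ∑ m ∈ M, w m :=
  ha.trans <| sum_le_sum_of_subset_of_nonneg (filter_subset _ _) fun m hm _ => hw m hm

lemma pR_empty {α : Type*} [DecidableEq α] {M : Finset (Finset α)} (hM : ∅ ∈ M) :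
    pR ∅ M = 0 := by
  have h : {p : ℝ | ∃ x : Finset α → ℝ, (∀ m ∈ M, 0 ≤ x m) ∧ (∑ m ∈ M, x m) = 1 ∧
      ∀ a ∈ (∅ : Finset α), p ≤ (∑ m ∈ M.filter (fun m => a ∈ m), x m)} = Set.univ := by
    refine Set.eq_univ_of_forall fun p => ⟨Pi.single ∅ 1, fun m _ => ?_, ?_, by simp⟩
    · by_cases hm : m = ∅ <;> simp [hm]
    · simp [Pi.single_apply, hM]
  rw [pR, h, Real.sSup_univ]

lemma fracCovNum_empty {α : Type*} [DecidableEq α] (M : Finset (Finset α)) :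
    fracCovNum ∅ M = 0 := by
  refine IsLeast.csInf_eq ⟨⟨0, by simp⟩, ?_⟩
  rintro s ⟨w, hw, -, rfl⟩
  exact sum_nonneg hw

/-- The Rawlsian justice value `p_R(A, M)` equals `1 / k_f^≥(A, M)`, the reciprocal
of the fractional covering number of the hypergraph `(A, M)`. -/
theorem pR_eq_inv_fracCovNum {α : Type*} [DecidableEq α]
    (A : Finset α) (M : Finset (Finset α))
    (hsub : ∀ m ∈ M, m ⊆ A) (hempty : ∅ ∈ M) (hcov : ∀ a ∈ A, ∃ m ∈ M, a ∈ m) :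
    pR A M = 1 / fracCovNum A M := by
  rcases A.eq_empty_or_nonempty with rfl | ⟨a₀, ha₀⟩
  · rw [pR_empty hempty, fracCovNum_empty, div_zero]
  unfold pR fracCovNum
  set S := {s : ℝ | ∃ w : Finset α → ℝ, (∀ m ∈ M, 0 ≤ w m) ∧
    (∀ a ∈ A, 1 ≤ (∑ m ∈ M.filter (fun m => a ∈ m), w m)) ∧ s = ∑ m ∈ M, w m}
  have hS_one : ∀ s ∈ S, 1 ≤ s := by
    rintro s ⟨w, hw, hwA, rfl⟩
    exact one_le_sum_of_one_le_sum_filter hw (hwA a₀ ha₀)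
  have hS_ne : S.Nonempty := by
    refine ⟨_, fun _ => 1, fun _ _ => zero_le_one, fun a ha => ?_, rfl⟩
    obtain ⟨m, hm, ham⟩ := hcov a ha
    have h : (M.filter (fun m => a ∈ m)).Nonempty := ⟨m, mem_filter.2 ⟨hm, ham⟩⟩
    simpa using h.card_pos
  have hk : 0 < sInf S := zero_lt_one.trans_le (le_csInf hS_ne hS_one)
  have hP : ∀ s ∈ S, 1 / s ∈ {p : ℝ | ∃ x : Finset α → ℝ, (∀ m ∈ M, 0 ≤ x m) ∧
      (∑ m ∈ M, x m) = 1 ∧ ∀ a ∈ A, p ≤ (∑ m ∈ M.filter (fun m => a ∈ m), x m)} := by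
    intro s hs
    have hs0 : 0 < s := zero_lt_one.trans_le (hS_one s hs)
    obtain ⟨w, hw, hwA, hsw⟩ := hs
    refine ⟨fun m => w m / s, fun m hm => div_nonneg (hw m hm) hs0.le, ?_, fun a ha => ?_⟩
    · rw [← sum_div, ← hsw, div_self hs0.ne']
    · rw [← sum_div]
      exact div_le_div_of_nonneg_right (hwA a ha) hs0.le
  refine IsLUB.csSup_eq ⟨?_, fun b hb => ?_⟩ (hS_ne.elim fun s hs => ⟨_, hP s hs⟩)
  · rintro p ⟨x, hx, hx1, hxA⟩
    rcases le_or_gt p 0 with hp | hp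
    · exact hp.trans (one_div_nonneg.2 hk.le)
    · rw [le_one_div hp hk]
      refine csInf_le ⟨1, hS_one⟩
        ⟨fun m => x m / p, fun m hm => div_nonneg (hx m hm) hp.le, fun a ha => ?_, ?_⟩
      · rw [← sum_div, one_le_div hp]
        exact hxA a ha
      · rw [← sum_div, hx1]
  · have hb0 : 0 < b := by
      obtain ⟨s, hs⟩ := hS_ne
      exact (one_div_pos.2 (zero_lt_one.trans_le (hS_one s hs))).trans_le (hb (hP s hs))
    rw [one_div_le hk hb0]
    refine le_csInf hS_ne fun s hs => ?_
    rw [one_div_le hb0 (zero_lt_one.trans_le (hS_one s hs))]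
    exact hb (hP s hs)
end

section
/- Let (A, M) be an independence system with |A| ≥ 2. Suppose (α, β) ∈ ℝ^A × ℝ satisfies ∑_{a ∈ m} α_a + β ≥ 0 for every m ∈ M and ∑_{a ∈ A} α_a = −1, and suppose β is minimal among all pairs satisfying these constraints. Then for every element ā ∈ A there exists a set m̄ ∈ M with ā ∈ m̄ such that ∑_{a ∈ m̄} α_a + β = 0. -/
open Finset

/-- For an independence system `(A, M)` with `|A| ≥ 2` and an optimal solution
`(w, β)` of the dual LP, every element `ā ∈ A` lies in a set `m̄ ∈ M` whose dual
constraint is binding. -/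
theorem exists_binding_constraint {α : Type*} [DecidableEq α]
    (A : Finset α) (M : Finset (Finset α))
    (hsub : ∀ m ∈ M, m ⊆ A) (hempty : ∅ ∈ M) (hcov : ∀ a ∈ A, ∃ m ∈ M, a ∈ m)
    (hind : ∀ m ∈ M, ∀ m' ⊆ m, m' ∈ M)
    (hA : 2 ≤ A.card)
    (w : α → ℝ) (β : ℝ)
    (hfeas : ∀ m ∈ M, 0 ≤ (∑ a ∈ m, w a) + β)
    (hsum : (∑ a ∈ A, w a) = -1)
    (hmin : ∀ (w' : α → ℝ) (β' : ℝ),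
      (∀ m ∈ M, 0 ≤ (∑ a ∈ m, w' a) + β') → (∑ a ∈ A, w' a) = -1 → β ≤ β') :
    ∀ abar ∈ A, ∃ mbar ∈ M, abar ∈ mbar ∧ (∑ a ∈ mbar, w a) + β = 0 := by
  intro b hb
  have hsing : ∀ a ∈ A, {a} ∈ M := fun a ha => by
    obtain ⟨m, hm, ham⟩ := hcov a ha
    exact hind m hm _ (by simpa using ham)
  have hβ : 0 < β := by
    by_contra! hβ
    have hnonneg : 0 ≤ ∑ a ∈ A, w a := Finset.sum_nonneg fun a ha => by
      have h := hfeas _ (hsing a ha)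
      rw [Finset.sum_singleton] at h
      linarith
    linarith
  by_contra! hslack
  obtain ⟨m₀, hm₀, hmin₀⟩ := Finset.exists_min_image (M.filter (b ∈ ·))
    (fun m => (∑ a ∈ m, w a) + β) ⟨{b}, by simpa using hsing b hb⟩
  rw [Finset.mem_filter] at hm₀
  have hs : 0 < (∑ a ∈ m₀, w a) + β :=
    lt_of_le_of_ne (hfeas _ hm₀.1) (hslack _ hm₀.1 hm₀.2).symm
  have hn : (0 : ℝ) < A.card := by exact_mod_cast (by omega : 0 < A.card)
  obtain ⟨t, ht, htβ, hts⟩ :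
      ∃ t : ℝ, 0 < t ∧ t ≤ β ∧ A.card * t ≤ (∑ a ∈ m₀, w a) + β := by
    refine ⟨min β (((∑ a ∈ m₀, w a) + β) / A.card), lt_min hβ (div_pos hs hn),
      min_le_left _ _, ?_⟩
    rw [mul_comm, ← le_div_iff₀ hn]
    exact min_le_right _ _
  -- Shift weight from `b` evenly onto all elements; every constraint becomes slack by `t`.
  have hshift (m : Finset α) : ∑ a ∈ m, (w a + t - if a = b then A.card * t else 0) =
      (∑ a ∈ m, w a) + m.card * t - if b ∈ m then A.card * t else 0 := by
    simp [Finset.sum_sub_distrib, Finset.sum_add_distrib]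
  have hle := hmin (fun a => w a + t - if a = b then A.card * t else 0) (β - t) ?_ ?_
  · linarith
  · intro m hm
    rw [hshift]
    rcases m.eq_empty_or_nonempty with rfl | hne
    · simpa using htβ
    have hcard : t ≤ m.card * t :=
      le_mul_of_one_le_left ht.le (by exact_mod_cast hne.card_pos)
    split_ifs with hbm
    · have h := hmin₀ m (Finset.mem_filter.2 ⟨hm, hbm⟩)
      linarith
    · have h := hfeas m hm
      linarith
  · rw [hshift, if_pos hb, hsum]
    ring
end

section
/- For any independence system (A, M), the uniform fairness value p_U(A, M) equals the Rawlsian justice value p_R(A, M). -/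
open Finset

/-- Deleting `a` from each set with probability `1 - r` scales the marginal at `a` by `r` and keeps
all other marginals. -/
theorem exists_scale_marginal {α : Type*} [DecidableEq α] {M : Finset (Finset α)} (a : α)
    (hM : ∀ m ∈ M, m.erase a ∈ M) {r : ℝ} (hr0 : 0 ≤ r) (hr1 : r ≤ 1)
    (x : Finset α → ℝ) (hx : ∀ m ∈ M, 0 ≤ x m) :
    ∃ y : Finset α → ℝ, (∀ m ∈ M, 0 ≤ y m) ∧ (∑ m ∈ M, y m) = ∑ m ∈ M, x m ∧
      (∑ m ∈ M.filter (fun m => a ∈ m), y m) = r * ∑ m ∈ M.filter (fun m => a ∈ m), x m ∧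
      ∀ b, b ≠ a →
        (∑ m ∈ M.filter (fun m => b ∈ m), y m) = ∑ m ∈ M.filter (fun m => b ∈ m), x m := by
  let y : Finset α → ℝ := fun m' => ∑ m ∈ M,
    x m * ((if m' = m then r else 0) + (if m' = m.erase a then 1 - r else 0))
  have push (f : Finset α → ℝ) : ∑ m' ∈ M, y m' * f m' =
      ∑ m ∈ M, x m * (r * f m + (1 - r) * f (m.erase a)) := by
    simp only [y, Finset.sum_mul]
    rw [Finset.sum_comm]
    refine Finset.sum_congr rfl fun m hm => ?_
    simp only [mul_assoc, ← Finset.mul_sum, add_mul, Finset.sum_add_distrib, ite_mul, zero_mul]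
    rw [Finset.sum_ite_eq_of_mem' _ _ _ hm, Finset.sum_ite_eq_of_mem' _ _ _ (hM m hm)]
  have marginal (z : Finset α → ℝ) (b : α) : ∑ m ∈ M.filter (fun m => b ∈ m), z m =
      ∑ m ∈ M, z m * (if b ∈ m then 1 else 0) := by
    simp [Finset.sum_filter]
  refine ⟨y, fun m' _ => Finset.sum_nonneg fun m hm => mul_nonneg (hx m hm) ?_, ?_, ?_, ?_⟩
  · have : 0 ≤ 1 - r := by linarith
    positivity
  · simpa using push fun _ => 1
  · rw [marginal, marginal, push, Finset.mul_sum]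
    refine Finset.sum_congr rfl fun m _ => ?_
    simp
    split_ifs <;> ring
  · intro b hb
    rw [marginal, marginal, push]
    refine Finset.sum_congr rfl fun m _ => ?_
    simp only [Finset.mem_erase, ne_eq, hb, not_false_eq_true, true_and]
    ring

/-- In a downward closed family, marginals that are at least `p ≥ 0` on `S` can be lowered to be
exactly `p` on `S`, without changing the other marginals. -/
theorem exists_marginal_eq {α : Type*} [DecidableEq α] {M : Finset (Finset α)}
    (hM : ∀ m ∈ M, ∀ m' ⊆ m, m' ∈ M) {p : ℝ} (hp : 0 ≤ p)
    (x : Finset α → ℝ) (hx : ∀ m ∈ M, 0 ≤ x m) (S : Finset α)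
    (hS : ∀ a ∈ S, p ≤ ∑ m ∈ M.filter (fun m => a ∈ m), x m) :
    ∃ y : Finset α → ℝ, (∀ m ∈ M, 0 ≤ y m) ∧ (∑ m ∈ M, y m) = ∑ m ∈ M, x m ∧
      (∀ a ∈ S, (∑ m ∈ M.filter (fun m => a ∈ m), y m) = p) ∧
      ∀ b ∉ S,
        (∑ m ∈ M.filter (fun m => b ∈ m), y m) = ∑ m ∈ M.filter (fun m => b ∈ m), x m := by
  induction S using Finset.induction_on with
  | empty => exact ⟨x, hx, rfl, by simp, fun _ _ => rfl⟩
  | insert a S ha ih =>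
    obtain ⟨y, hy0, hy1, hyS, hyc⟩ := ih fun b hb => hS b (Finset.mem_insert_of_mem hb)
    have hq := hS a (Finset.mem_insert_self a S)
    rw [← hyc a ha] at hq
    obtain ⟨z, hz0, hz1, hza, hzb⟩ := exists_scale_marginal a
      (fun m hm => hM m hm _ (Finset.erase_subset a m)) (div_nonneg hp (hp.trans hq))
      (div_le_one_of_le₀ hq (hp.trans hq)) y hy0
    refine ⟨z, hz0, hz1.trans hy1, fun b hb => ?_, fun b hb => ?_⟩
    · rcases Finset.mem_insert.1 hb with rfl | hbS
      · rw [hza]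
        exact div_mul_cancel_of_imp fun h => le_antisymm (h ▸ hq) hp
      · rw [hzb b (ne_of_mem_of_not_mem hbS ha), hyS b hbS]
    · rw [Finset.mem_insert, not_or] at hb
      rw [hzb b hb.1, hyc b hb.2]

/-- For any independence system `(A, M)`, the uniform fairness value equals the
Rawlsian justice value: `p_U(A, M) = p_R(A, M)`. -/
theorem pU_eq_pR_of_independenceSystem {α : Type*} [DecidableEq α]
    (A : Finset α) (M : Finset (Finset α))
    (hsub : ∀ m ∈ M, m ⊆ A) (hempty : ∅ ∈ M) (hcov : ∀ a ∈ A, ∃ m ∈ M, a ∈ m)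
    (hind : ∀ m ∈ M, ∀ m' ⊆ m, m' ∈ M) :
    pU A M = pR A M := by
  unfold pU pR
  rcases A.eq_empty_or_nonempty with rfl | ⟨a, ha⟩
  · simp
  have uniform_of_nonneg {p : ℝ} (hp : 0 ≤ p) (x : Finset α → ℝ) (hx : ∀ m ∈ M, 0 ≤ x m)
      (hx1 : ∑ m ∈ M, x m = 1) (hxp : ∀ a ∈ A, p ≤ ∑ m ∈ M.filter (fun m => a ∈ m), x m) :
      ∃ x : Finset α → ℝ, (∀ m ∈ M, 0 ≤ x m) ∧ (∑ m ∈ M, x m) = 1 ∧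
        ∀ a ∈ A, (∑ m ∈ M.filter (fun m => a ∈ m), x m) = p := by
    obtain ⟨y, hy0, hy1, hyA, -⟩ := exists_marginal_eq hind hp x hx A hxp
    exact ⟨y, hy0, hy1.trans hx1, hyA⟩
  have le_one {p : ℝ} {x : Finset α → ℝ} (hx : ∀ m ∈ M, 0 ≤ x m) (hx1 : ∑ m ∈ M, x m = 1)
      (hxp : ∀ a ∈ A, p ≤ ∑ m ∈ M.filter (fun m => a ∈ m), x m) : p ≤ 1 :=
    (hxp a ha).trans <| hx1 ▸ Finset.sum_le_sum_of_subset_of_nonneg (Finset.filter_subset _ _)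
      fun m hm _ => hx m hm
  have zero_mem : ∃ x : Finset α → ℝ, (∀ m ∈ M, 0 ≤ x m) ∧ (∑ m ∈ M, x m) = 1 ∧
      ∀ a ∈ A, (∑ m ∈ M.filter (fun m => a ∈ m), x m) = 0 := by
    have h0 (m : Finset α) : (0 : ℝ) ≤ if m = ∅ then 1 else 0 := by positivity
    exact uniform_of_nonneg le_rfl (fun m => if m = ∅ then 1 else 0) (fun m _ => h0 m)
      (by simp [hempty]) fun _ _ => Finset.sum_nonneg fun m _ => h0 m
  apply le_antisymm
  · refine csSup_le_csSup ⟨1, ?_⟩ ⟨0, zero_mem⟩ ?_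
    · rintro p ⟨x, hx, hx1, hxp⟩
      exact le_one hx hx1 hxp
    · rintro p ⟨x, hx, hx1, hxp⟩
      exact ⟨x, hx, hx1, fun b hb => (hxp b hb).ge⟩
  · obtain ⟨x₀, hx₀, hx₀1, hx₀p⟩ := zero_mem
    refine csSup_le ⟨0, x₀, hx₀, hx₀1, fun b hb => (hx₀p b hb).ge⟩ ?_
    rintro p ⟨x, hx, hx1, hxp⟩
    have bdd : BddAbove {p : ℝ | ∃ x : Finset α → ℝ, (∀ m ∈ M, 0 ≤ x m) ∧ (∑ m ∈ M, x m) = 1 ∧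
        ∀ a ∈ A, (∑ m ∈ M.filter (fun m => a ∈ m), x m) = p} := by
      refine ⟨1, ?_⟩
      rintro q ⟨z, hz, hz1, hzq⟩
      exact le_one hz hz1 fun b hb => (hzq b hb).ge
    rcases le_total 0 p with hp | hp
    · exact le_csSup bdd (uniform_of_nonneg hp x hx hx1 hxp)
    · exact hp.trans (le_csSup bdd ⟨x₀, hx₀, hx₀1, hx₀p⟩)
end

section
/- Let G = (V, E) be a finite simple graph with at least one edge, and consider the set system (E, M) where M is the family of all matchings of G. Then p_U(E, M) = p_R(E, M) = 1 / χ'_f(G), where χ'_f(G) is the fractional edge coloring number of G. -/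
open Finset

/-- The family of all matchings of `G`, as finsets of edges. -/
noncomputable def matchings {V : Type*} [Fintype V] [DecidableEq V]
    (G : SimpleGraph V) [DecidableRel G.Adj] : Finset (Finset (Sym2 V)) :=
  G.edgeFinset.powerset.filter
    (fun s => ∀ e ∈ s, ∀ f ∈ s, e ≠ f → ∀ v : V, ¬(v ∈ e ∧ v ∈ f))

/-- Shifting weight from each set `m` to `m.erase a` lowers the coverage of `a` to any prescribed
smaller value and changes neither the total weight nor the coverage of other elements. -/
lemma exists_weight_lower_coverage {α : Type*} [DecidableEq α] {M : Finset (Finset α)} {a : α}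
    (hM : ∀ m ∈ M, m.erase a ∈ M) {y : Finset α → ℝ} (hy : ∀ m ∈ M, 0 ≤ y m)
    {p : ℝ} (hp : 0 ≤ p) (hpa : p ≤ ∑ m ∈ M.filter (fun m => a ∈ m), y m) :
    ∃ z : Finset α → ℝ, (∀ m ∈ M, 0 ≤ z m) ∧ ∑ m ∈ M, z m = ∑ m ∈ M, y m ∧
      ∑ m ∈ M.filter (fun m => a ∈ m), z m = p ∧
      ∀ b, b ≠ a → ∑ m ∈ M.filter (fun m => b ∈ m), z m =
        ∑ m ∈ M.filter (fun m => b ∈ m), y m := by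
  obtain ⟨θ, hθ0, hθ1, hθ⟩ : ∃ θ : ℝ, 0 ≤ θ ∧ θ ≤ 1 ∧
      θ * ∑ m ∈ M.filter (fun m => a ∈ m), y m = p := by
    rcases hp.eq_or_lt with rfl | hp
    · exact ⟨0, le_rfl, zero_le_one, zero_mul _⟩
    · have hc := hp.trans_le hpa
      exact ⟨p / _, div_nonneg hp.le hc.le, (div_le_one hc).2 hpa, div_mul_cancel₀ _ hc.ne'⟩
  have key : ∀ f : Finset α → ℝ,
      ∑ m ∈ M, f m * (θ * y m + (1 - θ) * ∑ m' ∈ M with m'.erase a = m, y m') =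
        θ * ∑ m ∈ M, f m * y m + (1 - θ) * ∑ m ∈ M, f (m.erase a) * y m := by
    intro f
    rw [← Finset.sum_fiberwise_of_maps_to hM (fun m => f (m.erase a) * y m),
      Finset.mul_sum, Finset.mul_sum, ← Finset.sum_add_distrib]
    refine Finset.sum_congr rfl fun m _ => ?_
    have : ∑ m' ∈ M with m'.erase a = m, f (m'.erase a) * y m' =
        f m * ∑ m' ∈ M with m'.erase a = m, y m' := by
      rw [Finset.mul_sum]
      refine Finset.sum_congr rfl fun m' hm' => ?_
      rw [(Finset.mem_filter.1 hm').2]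
    rw [this]
    ring
  refine ⟨fun m => θ * y m + (1 - θ) * ∑ m' ∈ M with m'.erase a = m, y m', ?_, ?_, ?_, ?_⟩
  · intro m hm
    have h : 0 ≤ ∑ m' ∈ M with m'.erase a = m, y m' :=
      Finset.sum_nonneg fun m' hm' => hy m' (Finset.mem_filter.1 hm').1
    exact add_nonneg (mul_nonneg hθ0 (hy m hm)) (mul_nonneg (sub_nonneg.2 hθ1) h)
  · have h := key fun _ => 1
    simp only [one_mul] at h
    rw [h]
    ring
  · have h := key fun m => if a ∈ m then 1 else 0
    simpa [← Finset.sum_filter, ite_mul, hθ] using h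
  · intro b hb
    have h := key fun m => if b ∈ m then 1 else 0
    simp only [ite_mul, one_mul, zero_mul, ← Finset.sum_filter, Finset.mem_erase, ne_eq, hb,
      not_false_eq_true, true_and] at h
    rw [h]
    ring

/-- In a family closed under removal of elements, weights covering every element at least `p`
times can be replaced by weights of the same total covering every element exactly `p` times. -/
lemma exists_weight_coverage_eq {α : Type*} [DecidableEq α] {A : Finset α}
    {M : Finset (Finset α)} (hM : ∀ m ∈ M, ∀ a, m.erase a ∈ M) {x : Finset α → ℝ}
    (hx : ∀ m ∈ M, 0 ≤ x m) {p : ℝ} (hp : 0 ≤ p)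
    (hA : ∀ a ∈ A, p ≤ ∑ m ∈ M.filter (fun m => a ∈ m), x m) :
    ∃ y : Finset α → ℝ, (∀ m ∈ M, 0 ≤ y m) ∧ ∑ m ∈ M, y m = ∑ m ∈ M, x m ∧
      ∀ a ∈ A, ∑ m ∈ M.filter (fun m => a ∈ m), y m = p := by
  suffices h : ∃ y : Finset α → ℝ, (∀ m ∈ M, 0 ≤ y m) ∧ ∑ m ∈ M, y m = ∑ m ∈ M, x m ∧
      (∀ a ∈ A, ∑ m ∈ M.filter (fun m => a ∈ m), y m = p) ∧
      ∀ b ∉ A, ∑ m ∈ M.filter (fun m => b ∈ m), y m =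
        ∑ m ∈ M.filter (fun m => b ∈ m), x m by
    obtain ⟨y, h0, h1, h2, -⟩ := h
    exact ⟨y, h0, h1, h2⟩
  induction A using Finset.induction_on with
  | empty => exact ⟨x, hx, rfl, by simp, fun _ _ => rfl⟩
  | insert a B ha ih =>
    obtain ⟨y, hy, hsum, hyB, hyn⟩ := ih fun b hb => hA b (Finset.mem_insert_of_mem hb)
    obtain ⟨z, hz, hzsum, hza, hzb⟩ := exists_weight_lower_coverage (fun m hm => hM m hm a) hy hp
      ((hA a (Finset.mem_insert_self a B)).trans_eq (hyn a ha).symm)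
    refine ⟨z, hz, hzsum.trans hsum, fun b hb => ?_, fun b hb => ?_⟩
    · rcases Finset.mem_insert.1 hb with rfl | hb
      · exact hza
      · rw [hzb b (ne_of_mem_of_not_mem hb ha), hyB b hb]
    · rw [Finset.mem_insert, not_or] at hb
      rw [hzb b hb.1, hyn b hb.2]

lemma Real.sSup_eq_one_div_sInf {S C : Set ℝ} (hC : C.Nonempty) (hC1 : ∀ s ∈ C, 1 ≤ s)
    (hSC : ∀ p ∈ S, 0 < p → 1 / p ∈ C) (hCS : ∀ s ∈ C, 1 / s ∈ S) :
    sSup S = 1 / sInf C := by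
  have hpos : 0 < sInf C := zero_lt_one.trans_le (le_csInf hC hC1)
  have hle : ∀ p ∈ S, p ≤ 1 / sInf C := by
    intro p hp
    rcases le_or_gt p 0 with h | h
    · exact h.trans (one_div_pos.2 hpos).le
    · exact (le_one_div h hpos).2 (csInf_le ⟨1, hC1⟩ (hSC p hp h))
  have hS : ∀ s ∈ C, 1 / s ≤ sSup S := fun s hs => le_csSup ⟨_, hle⟩ (hCS s hs)
  obtain ⟨s₀, hs₀⟩ := hC
  have hsup : 0 < sSup S :=
    (one_div_pos.2 (zero_lt_one.trans_le (hC1 s₀ hs₀))).trans_le (hS s₀ hs₀)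
  refine le_antisymm (csSup_le ⟨_, hCS s₀ hs₀⟩ hle) ((one_div_le hpos hsup).2 ?_)
  exact le_csInf ⟨s₀, hs₀⟩ fun s hs =>
    (one_div_le (zero_lt_one.trans_le (hC1 s hs)) hsup).1 (hS s hs)

/-- For a nonempty ground set covered by a family closed under removal of elements, uniform
fairness and Rawlsian justice both equal the reciprocal of the fractional covering number. -/
lemma pU_eq_pR_eq_inv_fracCovNum {α : Type*} [DecidableEq α] {A : Finset α}
    {M : Finset (Finset α)} (hA : A.Nonempty) (hM : ∀ m ∈ M, ∀ a, m.erase a ∈ M)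
    (hcov : ∀ a ∈ A, ∃ m ∈ M, a ∈ m) :
    pU A M = 1 / fracCovNum A M ∧ pR A M = 1 / fracCovNum A M := by
  have hC : {s : ℝ | ∃ w : Finset α → ℝ, (∀ m ∈ M, 0 ≤ w m) ∧
      (∀ a ∈ A, 1 ≤ (∑ m ∈ M.filter (fun m => a ∈ m), w m)) ∧
      s = ∑ m ∈ M, w m}.Nonempty := by
    refine ⟨_, fun _ => 1, fun _ _ => zero_le_one, fun a ha => ?_, rfl⟩
    obtain ⟨m, hm, ham⟩ := hcov a ha
    exact Finset.single_le_sum (f := fun _ : Finset α => (1 : ℝ)) (fun _ _ => zero_le_one)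
      (Finset.mem_filter.2 ⟨hm, ham⟩)
  have hC1 : ∀ s ∈ {s : ℝ | ∃ w : Finset α → ℝ, (∀ m ∈ M, 0 ≤ w m) ∧
      (∀ a ∈ A, 1 ≤ (∑ m ∈ M.filter (fun m => a ∈ m), w m)) ∧
      s = ∑ m ∈ M, w m}, 1 ≤ s := by
    rintro _ ⟨w, hw, hwA, rfl⟩
    obtain ⟨a, ha⟩ := hA
    exact (hwA a ha).trans
      (Finset.sum_le_sum_of_subset_of_nonneg (Finset.filter_subset _ _) fun m hm _ => hw m hm)
  have hSC : ∀ p : ℝ, (∃ x : Finset α → ℝ, (∀ m ∈ M, 0 ≤ x m) ∧ (∑ m ∈ M, x m) = 1 ∧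
      ∀ a ∈ A, p ≤ (∑ m ∈ M.filter (fun m => a ∈ m), x m)) → 0 < p →
      ∃ w : Finset α → ℝ, (∀ m ∈ M, 0 ≤ w m) ∧
        (∀ a ∈ A, 1 ≤ (∑ m ∈ M.filter (fun m => a ∈ m), w m)) ∧ 1 / p = ∑ m ∈ M, w m := by
    rintro p ⟨x, hx, hsum, hxA⟩ hp
    refine ⟨fun m => x m / p, fun m hm => div_nonneg (hx m hm) hp.le, fun a ha => ?_, ?_⟩
    · rw [← Finset.sum_div, one_le_div hp]
      exact hxA a ha
    · rw [← Finset.sum_div, hsum]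
  have hCS : ∀ s ∈ {s : ℝ | ∃ w : Finset α → ℝ, (∀ m ∈ M, 0 ≤ w m) ∧
      (∀ a ∈ A, 1 ≤ (∑ m ∈ M.filter (fun m => a ∈ m), w m)) ∧ s = ∑ m ∈ M, w m},
      ∃ x : Finset α → ℝ, (∀ m ∈ M, 0 ≤ x m) ∧ (∑ m ∈ M, x m) = 1 ∧
        ∀ a ∈ A, (∑ m ∈ M.filter (fun m => a ∈ m), x m) = 1 / s := by
    intro s hs
    have hs0 : 0 < s := zero_lt_one.trans_le (hC1 s hs)
    obtain ⟨w, hw, hwA, hsum⟩ := hs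
    have hdiv : ∑ m ∈ M, w m / s = 1 := by rw [← Finset.sum_div, ← hsum, div_self hs0.ne']
    have hcovs : ∀ a ∈ A, 1 / s ≤ ∑ m ∈ M.filter (fun m => a ∈ m), w m / s := fun a ha => by
      rw [← Finset.sum_div]
      exact div_le_div_of_nonneg_right (hwA a ha) hs0.le
    obtain ⟨x, hx, hxsum, hxA⟩ := exists_weight_coverage_eq hM
      (fun m hm => div_nonneg (hw m hm) hs0.le) (one_div_pos.2 hs0).le hcovs
    exact ⟨x, hx, hxsum.trans hdiv, hxA⟩
  constructor
  · refine Real.sSup_eq_one_div_sInf hC hC1 (fun p ⟨x, hx, hsum, hxA⟩ => ?_) hCS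
    exact hSC p ⟨x, hx, hsum, fun a ha => (hxA a ha).ge⟩
  · refine Real.sSup_eq_one_div_sInf hC hC1 hSC fun s hs => ?_
    obtain ⟨x, hx, hsum, hxA⟩ := hCS s hs
    exact ⟨x, hx, hsum, fun a ha => (hxA a ha).ge⟩

/-- For a graph `G` with at least one edge, the uniform fairness and Rawlsian justice
values of the fair matching for edges set system both equal the reciprocal of the
fractional edge coloring number `χ'_f(G)` (which is the fractional covering number of
the hypergraph of matchings). -/
theorem fairMatchingEdges_pU_eq_pR_eq_inv_fracEdgeChromatic
    {V : Type*} [Fintype V] [DecidableEq V] (G : SimpleGraph V) [DecidableRel G.Adj]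
    (hE : G.edgeFinset.Nonempty) :
    pU G.edgeFinset (matchings G) = 1 / fracCovNum G.edgeFinset (matchings G) ∧
    pR G.edgeFinset (matchings G) = 1 / fracCovNum G.edgeFinset (matchings G) := by
  refine pU_eq_pR_eq_inv_fracCovNum hE (fun m hm a => ?_) fun e he => ⟨{e}, ?_, by simp⟩
  · simp only [matchings, Finset.mem_filter, Finset.mem_powerset] at hm ⊢
    exact ⟨(Finset.erase_subset a m).trans hm.1, fun e he f hf =>
      hm.2 e (Finset.mem_of_mem_erase he) f (Finset.mem_of_mem_erase hf)⟩
  · simp only [matchings, Finset.mem_filter, Finset.mem_powerset, Finset.singleton_subset_iff,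
      Finset.mem_singleton]
    exact ⟨he, fun f hf g hg hfg => absurd (hf.trans hg.symm) hfg⟩
end

section
/- Let G = (V, E) be a finite simple graph with at least one edge, and consider the set system (E, M) where M is the family of all matchings of G. Then 1 / (Δ(G) + 1) ≤ p_U(E, M) = p_R(E, M) ≤ 1 / Δ(G), where Δ(G) is the maximum degree of G. -/
open Finset

/-- A connected graph of maximum degree two has at most two vertices of degree at most one. -/
theorem SimpleGraph.false_of_three_reachable_endpoints {V : Type*} [Fintype V]
    (D : SimpleGraph V) [DecidableRel D.Adj] (h2 : ∀ v, D.degree v ≤ 2) {a b d : V}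
    (hab : a ≠ b) (had : a ≠ d) (hbd : b ≠ d)
    (ha : D.degree a ≤ 1) (hb : D.degree b ≤ 1) (hd : D.degree d ≤ 1)
    (rab : D.Reachable a b) (rad : D.Reachable a d) : False := by
  classical
  set C := D.connectedComponentMk a
  have hcard := C.connected_toSimpleGraph.card_vert_le_card_edgeSet_add_one
  rw [Nat.card_eq_fintype_card, Nat.card_eq_fintype_card, ← SimpleGraph.edgeFinset_card] at hcard
  have hsum := C.toSimpleGraph.sum_degrees_eq_twice_card_edges
  have hdeg (v : C) : C.toSimpleGraph.degree v ≤ D.degree v := 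
    (C.toSimpleGraph_hom.toCopy Subtype.val_injective).degree_le v
  let T : Finset C := {⟨a, rfl⟩, ⟨b, SimpleGraph.ConnectedComponent.sound rab.symm⟩,
    ⟨d, SimpleGraph.ConnectedComponent.sound rad.symm⟩}
  have hT : T.card = 3 := Finset.card_eq_three.2
    ⟨_, _, _, fun h => hab (congrArg Subtype.val h), fun h => had (congrArg Subtype.val h),
      fun h => hbd (congrArg Subtype.val h), rfl⟩
  have hle : ∑ v : C, (C.toSimpleGraph.degree v + if v ∈ T then 1 else 0) ≤ ∑ _v : C, 2 := by
    refine Finset.sum_le_sum fun v _ => ?_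
    have hv := hdeg v
    split_ifs with h
    · have : D.degree v ≤ 1 := by
        simp only [T, Finset.mem_insert, Finset.mem_singleton] at h
        rcases h with rfl | rfl | rfl <;> assumption
      omega
    · have := h2 v
      omega
  rw [Finset.sum_add_distrib, hsum] at hle
  simp [hT] at hle
  omega

section EdgeColoring

variable {V K : Type*}

/-- A partial edge coloring `c` is proper if edges at a common vertex have distinct colors. -/
def IsProperColoring (c : Sym2 V → Option K) : Prop :=
  ∀ u v w a, c s(u, v) = some a → c s(u, w) = some a → v = w

/-- No edge at `u` has color `a`. -/
def MissesColor (c : Sym2 V → Option K) (u : V) (a : K) : Prop :=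
  ∀ v, c s(u, v) ≠ some a

/-- The graph formed by the edges of color `a` or `b`. -/
def kempeGraph (c : Sym2 V → Option K) (a b : K) : SimpleGraph V where
  Adj u v := u ≠ v ∧ (c s(u, v) = some a ∨ c s(u, v) = some b)
  symm := ⟨fun u v h => by rwa [Sym2.eq_swap, ne_comm]⟩
  loopless := ⟨fun u h => h.1 rfl⟩

open Classical in
/-- Uncolor all edges at `x`. -/
noncomputable def uncolorAt (c : Sym2 V → Option K) (x : V) : Sym2 V → Option K :=
  fun e => if x ∈ e then none else c e

theorem IsProperColoring.isProperColoring_uncolorAt {c : Sym2 V → Option K} (hc : IsProperColoring c) (x : V) :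
    IsProperColoring (uncolorAt c x) := by
  intro u v w a h₁ h₂
  unfold uncolorAt at h₁ h₂
  split_ifs at h₁ h₂
  exact hc u v w a h₁ h₂

theorem MissesColor.missesColor_uncolorAt {c : Sym2 V → Option K} {u : V} {a : K} (h : MissesColor c u a)
    (x : V) : MissesColor (uncolorAt c x) u a := by
  intro v hv
  unfold uncolorAt at hv
  split_ifs at hv
  exact h v hv

theorem IsProperColoring.missesColor_uncolorAt {c : Sym2 V → Option K} (hc : IsProperColoring c)
    {x z : V} {a : K} (h : c s(x, z) = some a) : MissesColor (uncolorAt c x) z a := by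
  intro v hv
  unfold uncolorAt at hv
  split_ifs at hv with hx
  rw [Sym2.eq_swap] at h
  exact hx (by simp [hc z x v a h hv])

theorem IsProperColoring.degree_kempeGraph_le_two [Fintype V] {c : Sym2 V → Option K}
    (hc : IsProperColoring c) (a b : K) [DecidableRel (kempeGraph c a b).Adj] (v : V) :
    (kempeGraph c a b).degree v ≤ 2 := by
  classical
  rw [← SimpleGraph.card_neighborFinset_eq_degree]
  refine (Finset.card_le_card_of_injOn (t := {some a, some b}) (fun w => c s(v, w)) ?_ ?_).trans
    Finset.card_le_two
  · intro w hw
    simpa using ((SimpleGraph.mem_neighborFinset _ _ _).1 hw).2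
  · intro w hw w' _ h
    rcases ((SimpleGraph.mem_neighborFinset _ _ _).1 hw).2 with h' | h' <;>
      exact hc v w w' _ h' (h.symm.trans h')

theorem IsProperColoring.degree_kempeGraph_le_one [Fintype V] {c : Sym2 V → Option K}
    (hc : IsProperColoring c) (a : K) {b : K} [DecidableRel (kempeGraph c a b).Adj] {v : V}
    (hb : MissesColor c v b) : (kempeGraph c a b).degree v ≤ 1 := by
  rw [← SimpleGraph.card_neighborFinset_eq_degree, Finset.card_le_one]
  intro w hw w' hw'
  have h := ((SimpleGraph.mem_neighborFinset _ _ _).1 hw).2.resolve_right (hb w)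
  have h' := ((SimpleGraph.mem_neighborFinset _ _ _).1 hw').2.resolve_right (hb w')
  exact hc v w w' a h h'

theorem IsProperColoring.update [DecidableEq V] {c : Sym2 V → Option K}
    (hc : IsProperColoring c) {x y : V} {a : K} (hx : MissesColor c x a) (hy : MissesColor c y a) :
    IsProperColoring (Function.update c s(x, y) (some a)) := by
  intro u v w b h₁ h₂
  unfold MissesColor at hx hy
  simp only [Function.update_apply] at h₁ h₂
  split_ifs at h₁ h₂ with e₁ e₂ e₂
  · rw [Sym2.eq_iff] at e₁ e₂
    grind
  · rw [Sym2.eq_iff] at e₁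
    grind
  · rw [Sym2.eq_iff] at e₂
    grind
  · exact hc u v w b h₁ h₂

theorem IsProperColoring.update_none [DecidableEq V] {c : Sym2 V → Option K}
    (hc : IsProperColoring c) (e : Sym2 V) : IsProperColoring (Function.update c e none) := by
  intro u v w a h₁ h₂
  simp only [Function.update_apply] at h₁ h₂
  split_ifs at h₁ h₂
  exact hc u v w a h₁ h₂

/-- Exchanging two colors on a Kempe component preserves properness, the set of colored edges, and
acts on the missing colors of each vertex by the exchange exactly inside the component. -/
theorem IsProperColoring.exists_kempe_swap [DecidableEq K] {c : Sym2 V → Option K}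
    (hc : IsProperColoring c) (a b : K) (y : V) :
    ∃ c' : Sym2 V → Option K, IsProperColoring c' ∧ (∀ e, (c' e).isSome ↔ (c e).isSome) ∧
      (∀ v, ¬ (kempeGraph c a b).Reachable y v → MissesColor c v a → MissesColor c' v a) ∧
      ((MissesColor c y b) → MissesColor c' y a) := by
  classical
  let R := (kempeGraph c a b).Reachable y
  let c' : Sym2 V → Option K := fun e =>
    if ∃ v ∈ e, R v then (c e).map (Equiv.swap a b) else c e
  have key (u v : V) : c' s(u, v) = if R u then (c s(u, v)).map (Equiv.swap a b)
      else c s(u, v) := by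
    by_cases hu : R u
    · simp [c', hu]
    by_cases hv : R v
    · have huv : u ≠ v := fun h => hu (h ▸ hv)
      have hn : ¬ (kempeGraph c a b).Adj v u := fun h => hu (hv.trans h.reachable)
      have hn' : c s(u, v) ≠ some a ∧ c s(u, v) ≠ some b := by
        constructor <;> intro h <;> exact hn ⟨huv.symm, by rw [Sym2.eq_swap]; simp [h]⟩
      simp only [c', Sym2.mem_iff, exists_eq_or_imp, exists_eq_left, hu, hv, or_true, if_true,
        if_false]
      cases h : c s(u, v) with
      | none => rfl
      | some d =>
        rw [h] at hn'
        simp [Equiv.swap_apply_of_ne_of_ne (a := a) (b := b) (x := d) (by grind) (by grind)]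
    · simp [c', hu, hv]
  refine ⟨c', ?_, ?_, ?_, ?_⟩
  · intro u v w d h₁ h₂
    rw [key] at h₁ h₂
    split_ifs at h₁ h₂
    · obtain ⟨d₁, h₁, e₁⟩ := Option.map_eq_some_iff.1 h₁
      obtain ⟨d₂, h₂, e₂⟩ := Option.map_eq_some_iff.1 h₂
      obtain rfl := (Equiv.swap a b).injective (e₁.trans e₂.symm)
      exact hc u v w d₁ h₁ h₂
    · exact hc u v w d h₁ h₂
  · intro e
    simp only [c']
    split_ifs <;> simp
  · intro v hv hm w hw
    rw [key, if_neg hv] at hw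
    exact hm w hw
  · intro hm w hw
    rw [key, if_pos (SimpleGraph.Reachable.refl y)] at hw
    obtain ⟨d, h, e⟩ := Option.map_eq_some_iff.1 hw
    rw [Equiv.swap_apply_eq_iff, Equiv.swap_apply_left] at e
    exact hm w (e ▸ h)

/-- If a coloring of all edges of `F` except `xy` cannot be turned into a coloring of `F`, then a
Kempe chain joins `x` to `y`. -/
theorem IsProperColoring.reachable_kempeGraph [DecidableEq V] {F : Set (Sym2 V)}
    (hno : ∀ c : Sym2 V → Option K, IsProperColoring c → ¬ ∀ e, (c e).isSome ↔ e ∈ F)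
    {c : Sym2 V → Option K} (hc : IsProperColoring c) {x y : V} (hxy : s(x, y) ∈ F)
    (hdom : ∀ e, (c e).isSome ↔ e ∈ F ∧ e ≠ s(x, y)) {a b : K}
    (ha : MissesColor c x a) (hb : MissesColor c y b) :
    (kempeGraph c a b).Reachable y x := by
  classical
  by_contra hr
  obtain ⟨c', hc', hdom', hmiss, hy⟩ := hc.exists_kempe_swap a b y
  refine hno _ (hc'.update (hmiss x hr ha) (hy hb)) fun e => ?_
  by_cases he : e = s(x, y)
  · simp [he, hxy]
  · simp [hdom', hdom, he]

/-- A Kempe chain starting at `x`, where `x` misses one of the two colors, continues from the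
unique neighbor of `x` on the chain. -/
theorem IsProperColoring.reachable_uncolorAt {c : Sym2 V → Option K} (hc : IsProperColoring c)
    {x y z : V} {a b : K} (hxy : x ≠ y) (hxz : x ≠ z) (ha : MissesColor c x a)
    (hz : c s(x, z) = some b) (hr : (kempeGraph c a b).Reachable y x) :
    (kempeGraph (uncolorAt c x) a b).Reachable z y := by
  have hnbr {v : V} (h : (kempeGraph c a b).Adj x v) : v = z :=
    hc x v z b (h.2.resolve_left (ha v)) hz
  have key (u : V) (h : (kempeGraph c a b).Reachable u y) :
      (u ≠ x → (kempeGraph (uncolorAt c x) a b).Reachable u y) ∧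
      (u = x → (kempeGraph (uncolorAt c x) a b).Reachable z y) := by
    rw [SimpleGraph.reachable_iff_reflTransGen] at h
    induction h using Relation.ReflTransGen.head_induction_on with
    | refl => exact ⟨fun _ => .refl _, fun h => absurd h.symm hxy⟩
    | @head u v huv _ ih =>
      refine ⟨fun hu => ?_, ?_⟩
      · by_cases hv : v = x
        · subst hv
          exact hnbr huv.symm ▸ ih.2 rfl
        · refine SimpleGraph.Reachable.trans (SimpleGraph.Adj.reachable ⟨huv.1, ?_⟩) (ih.1 hv)
          simpa [uncolorAt, Ne.symm hu, Ne.symm hv] using huv.2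
      · rintro rfl
        obtain rfl := hnbr huv
        exact ih.1 hxz.symm
  exact (key x hr.symm).2 rfl

/-- **Vizing's adjacency step**: a proper coloring missing a color at every vertex can be modified
so as to color one further edge. -/
theorem IsProperColoring.exists_extend [Fintype V] [DecidableEq V] {F : Set (Sym2 V)}
    (hF : ∀ e ∈ F, ¬ e.IsDiag) {c₀ : Sym2 V → Option K} (hc₀ : IsProperColoring c₀)
    (hmiss : ∀ v, ∃ a, MissesColor c₀ v a) {x y₀ : V} (hxy₀ : s(x, y₀) ∈ F)
    (hdom₀ : ∀ e, (c₀ e).isSome ↔ e ∈ F ∧ e ≠ s(x, y₀)) :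
    ∃ c : Sym2 V → Option K, IsProperColoring c ∧ ∀ e, (c e).isSome ↔ e ∈ F := by
  classical
  by_contra! hno
  replace hno : ∀ c : Sym2 V → Option K, IsProperColoring c → ¬ ∀ e, (c e).isSome ↔ e ∈ F :=
    fun c hc h => by
      obtain ⟨e, he⟩ := hno c hc
      have := h e
      tauto
  choose m hm using hmiss
  obtain ⟨α, hα⟩ : ∃ α, MissesColor c₀ x α := ⟨m x, hm x⟩
  -- Arbitrarily long fans exist: `S` is the set of vertices whose edge to `x` has been recolored.
  have fan (n : ℕ) : ∃ (c : Sym2 V → Option K) (y : V) (S : Finset V), S.card = n ∧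
      IsProperColoring c ∧ s(x, y) ∈ F ∧ (∀ e, (c e).isSome ↔ e ∈ F ∧ e ≠ s(x, y)) ∧
      MissesColor c x α ∧ uncolorAt c x = uncolorAt c₀ x ∧ y ∉ S ∧
      (∀ z ∉ S, z ≠ y → c s(x, z) = c₀ s(x, z)) ∧
      ∀ z ∈ S, c s(x, z) = some (m z) ∧ ∃ w, c₀ s(x, w) = some (m z) ∧
        (kempeGraph (uncolorAt c₀ x) α (m z)).Reachable z w := by
    induction n with
    | zero =>
      exact ⟨c₀, y₀, ∅, rfl, hc₀, hxy₀, hdom₀, hα, rfl, by simp, fun _ _ _ => rfl, by simp⟩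
    | succ n ih =>
      obtain ⟨c, y, S, hS, hc, hxy, hdom, hcα, hun, hyS, hold, hnew⟩ := ih
      have hne {v : V} (h : s(x, v) ∈ F) : x ≠ v := fun h' => hF _ h (by simp [h'])
      have hcxy : c s(x, y) = none := by
        have := hdom s(x, y)
        simpa using this
      have hoff {u v : V} (hu : x ≠ u) (hv : x ≠ v) : c s(u, v) = c₀ s(u, v) := by
        simpa [uncolorAt, hu, hv] using congrFun hun s(u, v)
      have hcy : MissesColor c y (m y) := by
        intro v hv
        by_cases hxv : x = v
        · subst hxv
          rw [Sym2.eq_swap, hcxy] at hv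
          cases hv
        · exact hm y v (hoff (hne hxy) hxv ▸ hv)
      obtain ⟨z, hz⟩ : ∃ z, c s(x, z) = some (m y) := by
        by_contra! h
        refine hno _ (hc.update h hcy) fun e => ?_
        by_cases he : e = s(x, y)
        · simp [he, hxy]
        · simp [hdom, he]
      have hzF : s(x, z) ∈ F := ((hdom _).1 (by simp [hz])).1
      have hzy : z ≠ y := by
        rintro rfl
        rw [hcxy] at hz
        cases hz
      have hreach : (kempeGraph (uncolorAt c₀ x) α (m y)).Reachable z y :=
        hun ▸ hc.reachable_uncolorAt (hne hxy) (hne hzF) hcα hz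
          (hc.reachable_kempeGraph hno hxy hdom hcα hcy)
      by_cases hzS : z ∈ S
      · exfalso
        obtain ⟨hcz, w, hw, hzw⟩ := hnew z hzS
        have hmzy : m z = m y := Option.some.inj (hcz.symm.trans hz)
        rw [hmzy] at hw hzw
        have hwz : z ≠ w := by
          rintro rfl
          rw [Sym2.eq_swap] at hw
          exact hm z x (hmzy ▸ hw)
        have hwy : y ≠ w := by
          rintro rfl
          rw [Sym2.eq_swap] at hw
          exact hm y x hw
        have hp := hc₀.isProperColoring_uncolorAt x
        exact SimpleGraph.false_of_three_reachable_endpoints _ (hp.degree_kempeGraph_le_two α (m y))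
          hzy hwz hwy (hp.degree_kempeGraph_le_one α (hmzy ▸ (hm z).missesColor_uncolorAt x))
          (hp.degree_kempeGraph_le_one α ((hm y).missesColor_uncolorAt x))
          (hp.degree_kempeGraph_le_one α (hc₀.missesColor_uncolorAt hw)) hreach hzw
      · have hzy' : s(x, z) ≠ s(x, y) := mt Sym2.congr_right.1 hzy
        have hmα : m y ≠ α := fun h => hcα z (h ▸ hz)
        refine ⟨Function.update (Function.update c s(x, z) none) s(x, y) (some (m y)), z,
          insert y S, by simp [hyS, hS], (hc.update_none _).update ?_ ?_, hzF, ?_, ?_, ?_,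
          by simp [hzS, hzy], ?_, ?_⟩
        · intro v hv
          rw [Function.update_apply] at hv
          split_ifs at hv with h
          exact h (by rw [hc x v z _ hv hz])
        · intro v hv
          rw [Function.update_apply] at hv
          split_ifs at hv
          exact hcy v hv
        · intro e
          by_cases he : e = s(x, y)
          · simp [he, hxy, hzy'.symm]
          by_cases he' : e = s(x, z)
          · simp [he', hzy']
          · simp [hdom, he, he']
        · intro v hv
          simp only [Function.update_apply] at hv
          split_ifs at hv
          · exact hmα (Option.some.inj hv)
          · exact hcα v hv
        · rw [← hun]
          funext e
          by_cases hxe : x ∈ e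
          · simp [uncolorAt, hxe]
          · have h₁ : e ≠ s(x, y) := by rintro rfl; simp at hxe
            have h₂ : e ≠ s(x, z) := by rintro rfl; simp at hxe
            simp [uncolorAt, hxe, h₁, h₂]
        · intro v hv hvz
          simp only [Finset.mem_insert, not_or] at hv
          have h₁ : s(x, v) ≠ s(x, y) := mt Sym2.congr_right.1 hv.1
          have h₂ : s(x, v) ≠ s(x, z) := mt Sym2.congr_right.1 hvz
          rw [Function.update_of_ne h₁, Function.update_of_ne h₂, hold v hv.2 hv.1]
        · intro v hv
          rcases Finset.mem_insert.1 hv with rfl | hvS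
          · exact ⟨by simp, z, hold z hzS hzy ▸ hz, hreach.symm⟩
          · have h₁ : s(x, v) ≠ s(x, y) :=
              mt Sym2.congr_right.1 fun h => hyS (h ▸ hvS)
            have h₂ : s(x, v) ≠ s(x, z) :=
              mt Sym2.congr_right.1 fun h => hzS (h ▸ hvS)
            rw [Function.update_of_ne h₁, Function.update_of_ne h₂]
            exact hnew v hvS
  obtain ⟨_, _, S, hS, _⟩ := fan (Fintype.card V + 1)
  have := S.card_le_univ
  omega

/-- **Vizing's theorem**: a graph has a proper edge coloring with `Δ + 1` colors. -/
theorem SimpleGraph.exists_edge_coloring [Fintype V] [DecidableEq V] (G : SimpleGraph V)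
    [DecidableRel G.Adj] : ∃ c : Sym2 V → Option (Fin (G.maxDegree + 1)),
      IsProperColoring c ∧ ∀ e, (c e).isSome ↔ e ∈ G.edgeFinset := by
  suffices h : ∀ F ⊆ G.edgeFinset, ∃ c : Sym2 V → Option (Fin (G.maxDegree + 1)),
      IsProperColoring c ∧ ∀ e, (c e).isSome ↔ e ∈ F from h _ subset_rfl
  intro F
  induction F using Finset.induction_on with
  | empty => exact fun _ => ⟨fun _ => none, by simp [IsProperColoring], by simp⟩
  | insert e F he ih =>
    intro hF
    obtain ⟨c, hc, hdom⟩ := ih ((Finset.subset_insert _ _).trans hF)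
    induction e using Sym2.ind with
    | h x y =>
    refine IsProperColoring.exists_extend (F := {e | e ∈ insert s(x, y) F})
      (fun e he' => G.not_isDiag_of_mem_edgeFinset (hF he')) hc (fun v => ?_)
      (x := x) (y₀ := y) (by simp) fun e => ?_
    · by_contra! h
      simp only [MissesColor, not_forall, not_not] at h
      choose f hf using h
      have hinj : Function.Injective f := fun a b hab =>
        Option.some.inj ((hf a).symm.trans (hab ▸ hf b))
      have hcard := Finset.card_le_card_of_injOn (s := Finset.univ) (t := G.neighborFinset v) f
        (fun a _ => by
          have : s(v, f a) ∈ G.edgeFinset :=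
            hF (Finset.mem_insert_of_mem ((hdom _).1 (by simp [hf a])))
          simpa using this) hinj.injOn
      rw [Finset.card_univ, Fintype.card_fin, SimpleGraph.card_neighborFinset_eq_degree] at hcard
      have := G.degree_le_maxDegree v
      omega
    · rw [hdom]
      simp only [Set.mem_ofPred_eq, Finset.mem_insert]
      grind

end EdgeColoring

section SetSystem

variable {α : Type*} [DecidableEq α]

theorem sum_filter_sum_fiber {ι β : Type*} [DecidableEq β] {s : Finset ι} {t : Finset β}
    {g : ι → β} (hg : ∀ i ∈ s, g i ∈ t) (f : ι → ℝ) (P : β → Prop) [DecidablePred P] :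
    ∑ b ∈ t with P b, ∑ i ∈ s with g i = b, f i = ∑ i ∈ s with P (g i), f i := by
  have h := Finset.sum_fiberwise_of_maps_to hg fun i => if P (g i) then f i else 0
  rw [Finset.sum_filter, Finset.sum_filter, ← h]
  refine Finset.sum_congr rfl fun b _ => ?_
  split_ifs with hb
  · refine Finset.sum_congr rfl fun i hi => ?_
    rw [(Finset.mem_filter.1 hi).2, if_pos hb]
  · refine (Finset.sum_eq_zero fun i hi => ?_).symm
    rw [(Finset.mem_filter.1 hi).2, if_neg hb]

/-- In a set system closed under removing elements, a distribution covering every element of `A`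
with probability at least `p ≥ 0` can be thinned to cover each with probability exactly `p`. -/
theorem exists_uniform_of_le {A : Finset α} {M : Finset (Finset α)}
    (hM : ∀ m ∈ M, ∀ e, m.erase e ∈ M) {x : Finset α → ℝ} (hx₀ : ∀ m ∈ M, 0 ≤ x m)
    (hx₁ : ∑ m ∈ M, x m = 1) {p : ℝ} (hp₀ : 0 ≤ p)
    (hp : ∀ a ∈ A, p ≤ ∑ m ∈ M with a ∈ m, x m) :
    ∃ x' : Finset α → ℝ, (∀ m ∈ M, 0 ≤ x' m) ∧ ∑ m ∈ M, x' m = 1 ∧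
      ∀ a ∈ A, ∑ m ∈ M with a ∈ m, x' m = p := by
  suffices h : ∀ T ⊆ A, ∃ x' : Finset α → ℝ, (∀ m ∈ M, 0 ≤ x' m) ∧ ∑ m ∈ M, x' m = 1 ∧
      (∀ a ∈ A, p ≤ ∑ m ∈ M with a ∈ m, x' m) ∧ ∀ a ∈ T, ∑ m ∈ M with a ∈ m, x' m = p by
    obtain ⟨x', h₀, h₁, -, h⟩ := h A subset_rfl
    exact ⟨x', h₀, h₁, h⟩
  intro T
  induction T using Finset.induction_on with
  | empty => exact fun _ => ⟨x, hx₀, hx₁, hp, by simp⟩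
  | insert e T he ih =>
    intro hT
    obtain ⟨z, hz₀, hz₁, hzA, hzT⟩ := ih ((Finset.subset_insert _ _).trans hT)
    have hM' : ∀ m ∈ M, m.erase e ∈ M := fun m hm => hM m hm e
    have hq := hzA e (hT (Finset.mem_insert_self _ _))
    obtain ⟨t, ht₀, ht₁, ht⟩ : ∃ t : ℝ, 0 ≤ t ∧ t ≤ 1 ∧ t * ∑ m ∈ M with e ∈ m, z m = p := by
      rcases hp₀.eq_or_lt with rfl | hpos
      · exact ⟨0, le_rfl, zero_le_one, zero_mul _⟩
      · exact ⟨_, div_nonneg hp₀ (hp₀.trans hq), div_le_one_of_le₀ hq (hp₀.trans hq),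
          div_mul_cancel₀ _ (hpos.trans_le hq).ne'⟩
    let y : Finset α → ℝ := fun m => ∑ m' ∈ M with m'.erase e = m, z m'
    have hload {a : α} (ha : a ≠ e) :
        ∑ m ∈ M with a ∈ m, (t * z m + (1 - t) * y m) = ∑ m ∈ M with a ∈ m, z m := by
      rw [Finset.sum_add_distrib, ← Finset.mul_sum, ← Finset.mul_sum,
        sum_filter_sum_fiber hM' z (a ∈ ·)]
      simp only [Finset.mem_erase, ne_eq, ha, not_false_eq_true, true_and]
      ring
    have hload_self : ∑ m ∈ M with e ∈ m, (t * z m + (1 - t) * y m) = p := by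
      rw [Finset.sum_add_distrib, ← Finset.mul_sum, ← Finset.mul_sum,
        sum_filter_sum_fiber hM' z (e ∈ ·), ht]
      simp
    refine ⟨fun m => t * z m + (1 - t) * y m, fun m hm => ?_, ?_, fun a ha => ?_, fun a ha => ?_⟩
    · exact add_nonneg (mul_nonneg ht₀ (hz₀ m hm)) (mul_nonneg (sub_nonneg.2 ht₁)
        (Finset.sum_nonneg fun m' hm' => hz₀ m' (Finset.mem_filter.1 hm').1))
    · rw [Finset.sum_add_distrib, ← Finset.mul_sum, ← Finset.mul_sum,
        Finset.sum_fiberwise_of_maps_to hM', hz₁]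
      ring
    · by_cases hae : a = e
      · subst hae
        exact hload_self.ge
      · exact (hzA a ha).trans_eq (hload hae).symm
    · by_cases hae : a = e
      · subst hae
        exact hload_self
      · exact (hload hae).trans (hzT a ((Finset.mem_insert.1 ha).resolve_left hae))

end SetSystem

section Matchings

variable {V : Type*} [Fintype V] [DecidableEq V] (G : SimpleGraph V) [DecidableRel G.Adj]

theorem mem_matchings {G : SimpleGraph V} [DecidableRel G.Adj] {m : Finset (Sym2 V)} :
    m ∈ matchings G ↔ m ⊆ G.edgeFinset ∧
      ∀ e ∈ m, ∀ f ∈ m, e ≠ f → ∀ v : V, ¬(v ∈ e ∧ v ∈ f) := by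
  rw [matchings, Finset.mem_filter, Finset.mem_powerset]

theorem mem_matchings_of_subset {G : SimpleGraph V} [DecidableRel G.Adj] {m m' : Finset (Sym2 V)}
    (hm : m ∈ matchings G) (h : m' ⊆ m) : m' ∈ matchings G := by
  rw [mem_matchings] at hm ⊢
  exact ⟨h.trans hm.1, fun e he f hf => hm.2 e (h he) f (h hf)⟩

/-- The color classes of a proper edge coloring with `Δ + 1` colors, chosen uniformly at random,
cover every edge with probability `1 / (Δ + 1)`. -/
theorem exists_uniform_matchings :
    ∃ x : Finset (Sym2 V) → ℝ, (∀ m ∈ matchings G, 0 ≤ x m) ∧ ∑ m ∈ matchings G, x m = 1 ∧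
      ∀ e ∈ G.edgeFinset, ∑ m ∈ matchings G with e ∈ m, x m = 1 / ((G.maxDegree : ℝ) + 1) := by
  obtain ⟨c, hc, hdom⟩ := G.exists_edge_coloring
  let cls : Fin (G.maxDegree + 1) → Finset (Sym2 V) := fun a => {e ∈ G.edgeFinset | c e = some a}
  have hcls (a) : cls a ∈ matchings G := by
    refine mem_matchings.2 ⟨Finset.filter_subset _ _, ?_⟩
    rintro e he f hf hef v ⟨hve, hvf⟩
    obtain ⟨u, rfl⟩ := hve
    obtain ⟨w, rfl⟩ := hvf
    exact hef (by rw [hc v u w a (Finset.mem_filter.1 he).2 (Finset.mem_filter.1 hf).2])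
  refine ⟨fun m => ∑ a with cls a = m, (1 / ((G.maxDegree : ℝ) + 1)),
    fun m _ => Finset.sum_nonneg fun _ _ => by positivity, ?_, fun e he => ?_⟩
  · have hpos : (G.maxDegree : ℝ) + 1 ≠ 0 := by positivity
    rw [Finset.sum_fiberwise_of_maps_to fun a _ => hcls a]
    simp [hpos]
  · obtain ⟨a, ha⟩ := Option.isSome_iff_exists.1 ((hdom e).2 he)
    rw [sum_filter_sum_fiber (fun a _ => hcls a) _ (e ∈ ·)]
    have : ({b | e ∈ cls b} : Finset (Fin (G.maxDegree + 1))) = {a} := by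
      ext b
      simp only [cls, Finset.mem_filter, Finset.mem_univ, true_and, he, ha, Option.some.injEq,
        Finset.mem_singleton]
      exact eq_comm
    rw [this, Finset.sum_singleton]

/-- A distribution on matchings covering every edge with probability at least `p` has
`Δ * p ≤ 1`, as a matching meets the edges at a vertex at most once. -/
theorem maxDegree_mul_le_one [Nonempty V] {x : Finset (Sym2 V) → ℝ}
    (hx₀ : ∀ m ∈ matchings G, 0 ≤ x m) (hx₁ : ∑ m ∈ matchings G, x m = 1) {p : ℝ}
    (hp : ∀ e ∈ G.edgeFinset, p ≤ ∑ m ∈ matchings G with e ∈ m, x m) :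
    (G.maxDegree : ℝ) * p ≤ 1 := by
  obtain ⟨v, hv⟩ := G.exists_maximal_degree_vertex
  calc (G.maxDegree : ℝ) * p = ∑ _e ∈ G.incidenceFinset v, p := by
        rw [Finset.sum_const, G.card_incidenceFinset_eq_degree, hv, nsmul_eq_mul]
    _ ≤ ∑ e ∈ G.incidenceFinset v, ∑ m ∈ matchings G with e ∈ m, x m :=
        Finset.sum_le_sum fun e he => hp e (G.incidenceFinset_subset v he)
    _ = ∑ m ∈ matchings G, ∑ e ∈ G.incidenceFinset v with e ∈ m, x m := by
        simp_rw [Finset.sum_filter]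
        exact Finset.sum_comm
    _ ≤ ∑ m ∈ matchings G, x m := by
        refine Finset.sum_le_sum fun m hm => ?_
        rw [Finset.sum_const, nsmul_eq_mul]
        refine mul_le_of_le_one_left (hx₀ m hm) (Nat.cast_le_one.2 (Finset.card_le_one.2 ?_))
        intro e he f hf
        simp only [Finset.mem_filter, SimpleGraph.mem_incidenceFinset] at he hf
        by_contra hef
        exact (mem_matchings.1 hm).2 e he.2 f hf.2 hef v ⟨he.1.2, hf.1.2⟩
    _ = 1 := hx₁

end Matchings

/-- For a graph `G` with at least one edge, the uniform fairness and Rawlsian justice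
values of the fair matching for edges set system coincide and lie between
`1 / (Δ(G) + 1)` and `1 / Δ(G)`. -/
theorem fairMatchingEdges_bounds
    {V : Type*} [Fintype V] [DecidableEq V] (G : SimpleGraph V) [DecidableRel G.Adj]
    (hE : G.edgeFinset.Nonempty) :
    1 / ((G.maxDegree : ℝ) + 1) ≤ pU G.edgeFinset (matchings G) ∧
    pU G.edgeFinset (matchings G) = pR G.edgeFinset (matchings G) ∧
    pR G.edgeFinset (matchings G) ≤ 1 / (G.maxDegree : ℝ) := by
  obtain ⟨e, he⟩ := hE
  have : Nonempty V := ⟨e.out.1⟩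
  have hΔ : 0 < (G.maxDegree : ℝ) := by
    induction e using Sym2.ind with
    | h u v =>
    have hdeg : 0 < G.degree u :=
      (G.degree_pos_iff_exists_adj u).2 ⟨v, SimpleGraph.mem_edgeFinset.1 he⟩
    exact_mod_cast hdeg.trans_le (G.degree_le_maxDegree u)
  obtain ⟨x, hx₀, hx₁, hx⟩ := exists_uniform_matchings G
  have hboundR : ∀ p ∈ {p : ℝ | ∃ x : Finset (Sym2 V) → ℝ, (∀ m ∈ matchings G, 0 ≤ x m) ∧
      (∑ m ∈ matchings G, x m) = 1 ∧
      ∀ a ∈ G.edgeFinset, p ≤ (∑ m ∈ (matchings G).filter (fun m => a ∈ m), x m)},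
      p ≤ 1 / (G.maxDegree : ℝ) := by
    rintro p ⟨x, hx₀, hx₁, hx⟩
    rw [le_div_iff₀ hΔ, mul_comm]
    exact maxDegree_mul_le_one G hx₀ hx₁ hx
  have hbddU : BddAbove {p : ℝ | ∃ x : Finset (Sym2 V) → ℝ, (∀ m ∈ matchings G, 0 ≤ x m) ∧
      (∑ m ∈ matchings G, x m) = 1 ∧
      ∀ a ∈ G.edgeFinset, (∑ m ∈ (matchings G).filter (fun m => a ∈ m), x m) = p} :=
    ⟨_, fun p ⟨x, hx₀, hx₁, hx⟩ => hboundR p ⟨x, hx₀, hx₁, fun a ha => (hx a ha).ge⟩⟩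
  have hlow : 1 / ((G.maxDegree : ℝ) + 1) ≤ pU G.edgeFinset (matchings G) :=
    le_csSup hbddU ⟨x, hx₀, hx₁, hx⟩
  refine ⟨hlow, le_antisymm ?_ ?_, ?_⟩
  · exact csSup_le_csSup ⟨_, hboundR⟩ ⟨_, x, hx₀, hx₁, hx⟩
      fun p ⟨x, hx₀, hx₁, hx⟩ => ⟨x, hx₀, hx₁, fun a ha => (hx a ha).ge⟩
  · refine csSup_le ⟨_, x, hx₀, hx₁, fun a ha => (hx a ha).ge⟩ ?_
    rintro p ⟨z, hz₀, hz₁, hz⟩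
    rcases le_total 0 p with hp | hp
    · exact le_csSup hbddU (exists_uniform_of_le
        (fun m hm a => mem_matchings_of_subset hm (Finset.erase_subset a m)) hz₀ hz₁ hp hz)
    · exact hp.trans (le_trans (by positivity) hlow)
  · exact csSup_le ⟨_, x, hx₀, hx₁, fun a ha => (hx a ha).ge⟩ hboundR
end

section
/- Let G = (V, E) be a finite simple graph with nonempty vertex set, and consider the set system (V, K) where K is the family of all vertex covers of G. Then the minimum uniform fairness value p_U^vc(V, K) and the minimum Rawlsian justice value p_R^vc(V, K) satisfy p_U^vc(V, K) = p_R^vc(V, K) = 1 − 1 / χ_f(G), where χ_f(G) is the fractional vertex coloring number of G. -/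
open Finset

/-- The family of all independent sets of `G`. -/
noncomputable def indepSets {V : Type*} [Fintype V] [DecidableEq V]
    (G : SimpleGraph V) [DecidableRel G.Adj] : Finset (Finset V) :=
  Finset.univ.powerset.filter (fun s => ∀ u ∈ s, ∀ v ∈ s, u ≠ v → ¬ G.Adj u v)

/-- The fractional vertex coloring number `χ_f(G)`: the fractional covering number of
the hypergraph of independent sets of `G`. -/
noncomputable def fracChromaticNumber {V : Type*} [Fintype V] [DecidableEq V]
    (G : SimpleGraph V) [DecidableRel G.Adj] : ℝ :=
  fracCovNum Finset.univ (indepSets G)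

/-- The family of all vertex covers of `G`. -/
noncomputable def vertexCovers {V : Type*} [Fintype V] [DecidableEq V]
    (G : SimpleGraph V) [DecidableRel G.Adj] : Finset (Finset V) :=
  Finset.univ.powerset.filter (fun s => ∀ u v : V, G.Adj u v → u ∈ s ∨ v ∈ s)

/-- The minimum uniform fairness value: the minimum `p` such that some probability
distribution over the family `M` selects every element of `A` with probability
exactly `p`. -/
noncomputable def pUmin {α : Type*} [DecidableEq α] (A : Finset α) (M : Finset (Finset α)) : ℝ :=
  sInf {p : ℝ | ∃ x : Finset α → ℝ, (∀ m ∈ M, 0 ≤ x m) ∧ (∑ m ∈ M, x m) = 1 ∧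
    ∀ a ∈ A, (∑ m ∈ M.filter (fun m => a ∈ m), x m) = p}

/-- The minimum Rawlsian justice value: the minimum `p` such that some probability
distribution over the family `M` selects every element of `A` with probability
at most `p`. -/
noncomputable def pRmin {α : Type*} [DecidableEq α] (A : Finset α) (M : Finset (Finset α)) : ℝ :=
  sInf {p : ℝ | ∃ x : Finset α → ℝ, (∀ m ∈ M, 0 ≤ x m) ∧ (∑ m ∈ M, x m) = 1 ∧
    ∀ a ∈ A, (∑ m ∈ M.filter (fun m => a ∈ m), x m) ≤ p}

/-- Shrinking a fractional cover at one element: for a family closed under erasing `a`, the weight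
of the sets containing `a` can be scaled to `1` without changing the total weight or the weight on
any other element. -/
theorem exists_weight_erase {α : Type*} [DecidableEq α] {M : Finset (Finset α)} {a : α}
    (hM : ∀ m ∈ M, m.erase a ∈ M) {w : Finset α → ℝ} (hw : ∀ m ∈ M, 0 ≤ w m)
    (ha : 1 ≤ ∑ m ∈ M.filter (fun m => a ∈ m), w m) :
    ∃ w' : Finset α → ℝ, (∀ m ∈ M, 0 ≤ w' m) ∧ ∑ m ∈ M, w' m = ∑ m ∈ M, w m ∧
      ∑ m ∈ M.filter (fun m => a ∈ m), w' m = 1 ∧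
      ∀ b, b ≠ a → ∑ m ∈ M.filter (fun m => b ∈ m), w' m =
        ∑ m ∈ M.filter (fun m => b ∈ m), w m := by
  set c := ∑ m ∈ M.filter (fun m => a ∈ m), w m with hc
  have hc0 : 0 < c := by linarith
  have hpush (f : Finset α → ℝ) :
      ∑ m ∈ M, (c⁻¹ * w m + (1 - c⁻¹) * ∑ S ∈ M.filter (fun S => S.erase a = m), w S) * f m =
        c⁻¹ * ∑ m ∈ M, w m * f m + (1 - c⁻¹) * ∑ m ∈ M, w m * f (m.erase a) := by
    rw [← Finset.sum_fiberwise_of_maps_to hM (fun m => w m * f (m.erase a)), Finset.mul_sum,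
      Finset.mul_sum, ← Finset.sum_add_distrib]
    refine Finset.sum_congr rfl fun m _ => ?_
    have : ∑ S ∈ M.filter (fun S => S.erase a = m), w S * f (S.erase a) =
        (∑ S ∈ M.filter (fun S => S.erase a = m), w S) * f m := by
      rw [Finset.sum_mul]
      refine Finset.sum_congr rfl fun S hS => ?_
      rw [(Finset.mem_filter.mp hS).2]
    rw [this]
    ring
  refine ⟨fun m => c⁻¹ * w m + (1 - c⁻¹) * ∑ S ∈ M.filter (fun S => S.erase a = m), w S,
    fun m hm => ?_, ?_, ?_, fun b hb => ?_⟩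
  · have h1 : 0 ≤ 1 - c⁻¹ := sub_nonneg.mpr (inv_le_one_of_one_le₀ ha)
    exact add_nonneg (mul_nonneg (inv_nonneg.mpr hc0.le) (hw m hm)) (mul_nonneg h1
      (Finset.sum_nonneg fun S hS => hw S (Finset.mem_filter.mp hS).1))
  · have := hpush fun _ => 1
    simp only [mul_one] at this
    rw [this]
    ring
  · have := hpush fun m => if a ∈ m then 1 else 0
    simp only [mul_ite, mul_one, mul_zero, Finset.notMem_erase, if_false, Finset.sum_const_zero,
      add_zero, ← Finset.sum_filter] at this
    rw [this, ← hc, inv_mul_cancel₀ hc0.ne']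
  · have := hpush fun m => if b ∈ m then 1 else 0
    simp only [mul_ite, mul_one, mul_zero, Finset.mem_erase, ne_eq, hb, not_false_eq_true,
      true_and, ← Finset.sum_filter] at this
    rw [this]
    ring

/-- In a family closed under erasing elements, every fractional cover can be turned into a
fractional partition of the same total weight. -/
theorem exists_fracPartition_of_fracCover {α : Type*} [DecidableEq α] {M : Finset (Finset α)}
    (hM : ∀ a, ∀ m ∈ M, m.erase a ∈ M) {w : Finset α → ℝ} (hw : ∀ m ∈ M, 0 ≤ w m)
    (A : Finset α) (hA : ∀ a ∈ A, 1 ≤ ∑ m ∈ M.filter (fun m => a ∈ m), w m) :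
    ∃ w' : Finset α → ℝ, (∀ m ∈ M, 0 ≤ w' m) ∧ ∑ m ∈ M, w' m = ∑ m ∈ M, w m ∧
      ∀ a ∈ A, ∑ m ∈ M.filter (fun m => a ∈ m), w' m = 1 := by
  suffices h : ∀ B ⊆ A, ∃ w' : Finset α → ℝ, (∀ m ∈ M, 0 ≤ w' m) ∧
      ∑ m ∈ M, w' m = ∑ m ∈ M, w m ∧
      (∀ a ∈ B, ∑ m ∈ M.filter (fun m => a ∈ m), w' m = 1) ∧
      ∀ a ∈ A, 1 ≤ ∑ m ∈ M.filter (fun m => a ∈ m), w' m by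
    obtain ⟨w', h0, ht, h1, -⟩ := h A subset_rfl
    exact ⟨w', h0, ht, h1⟩
  intro B
  induction B using Finset.induction_on with
  | empty => exact fun _ => ⟨w, hw, rfl, by simp, hA⟩
  | insert a B _ ih =>
    intro hB
    obtain ⟨w₁, h0₁, ht₁, hB₁, hA₁⟩ := ih ((Finset.subset_insert a B).trans hB)
    obtain ⟨w₂, h0₂, ht₂, ha₂, hb₂⟩ :=
      exists_weight_erase (hM a) h0₁ (hA₁ a (hB (Finset.mem_insert_self a B)))
    refine ⟨w₂, h0₂, ht₂.trans ht₁, fun b hb => ?_, fun b hb => ?_⟩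
    · by_cases hba : b = a
      · rw [hba, ha₂]
      · rw [hb₂ b hba, hB₁ b (Finset.mem_of_mem_insert_of_ne hb hba)]
    · by_cases hba : b = a
      · rw [hba, ha₂]
      · exact (hA₁ b hb).trans_eq (hb₂ b hba).symm

theorem mem_indepSets {V : Type*} [Fintype V] [DecidableEq V] {G : SimpleGraph V}
    [DecidableRel G.Adj] {s : Finset V} :
    s ∈ indepSets G ↔ ∀ u ∈ s, ∀ v ∈ s, ¬ G.Adj u v := by
  simp only [indepSets, Finset.powerset_univ, Finset.mem_filter, Finset.mem_univ, true_and]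
  exact ⟨fun h u hu v hv huv => h u hu v hv huv.ne huv, fun h u hu v hv _ => h u hu v hv⟩

theorem compl_mem_indepSets {V : Type*} [Fintype V] [DecidableEq V] {G : SimpleGraph V}
    [DecidableRel G.Adj] {s : Finset V} : sᶜ ∈ indepSets G ↔ s ∈ vertexCovers G := by
  simp only [mem_indepSets, vertexCovers, Finset.powerset_univ, Finset.mem_filter,
    Finset.mem_univ, true_and, Finset.mem_compl]
  grind

theorem compl_mem_vertexCovers {V : Type*} [Fintype V] [DecidableEq V] {G : SimpleGraph V}
    [DecidableRel G.Adj] {s : Finset V} : sᶜ ∈ vertexCovers G ↔ s ∈ indepSets G := by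
  rw [← compl_mem_indepSets, compl_compl]

theorem sum_vertexCovers {V : Type*} [Fintype V] [DecidableEq V] (G : SimpleGraph V)
    [DecidableRel G.Adj] (x : Finset V → ℝ) :
    ∑ C ∈ vertexCovers G, x C = ∑ S ∈ indepSets G, x Sᶜ :=
  Finset.sum_nbij' compl compl (fun _ h => compl_mem_indepSets.mpr h)
    (fun _ h => compl_mem_vertexCovers.mpr h) (by simp) (by simp) (by simp)

theorem sum_vertexCovers_filter_mem {V : Type*} [Fintype V] [DecidableEq V] (G : SimpleGraph V)
    [DecidableRel G.Adj] (x : Finset V → ℝ) (v : V) :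
    ∑ C ∈ (vertexCovers G).filter (fun C => v ∈ C), x C =
      ∑ C ∈ vertexCovers G, x C - ∑ S ∈ (indepSets G).filter (fun S => v ∈ S), x Sᶜ := by
  rw [Finset.sum_filter, sum_vertexCovers, sum_vertexCovers, Finset.sum_filter,
    ← Finset.sum_sub_distrib]
  refine Finset.sum_congr rfl fun S _ => ?_
  by_cases h : v ∈ S <;> simp [h]

/-- A fractional coloring of total weight `s` yields a distribution over vertex covers that
selects every vertex with probability exactly `1 - 1 / s`. -/
theorem exists_uniform_vertexCover_distribution {V : Type*} [Fintype V] [DecidableEq V]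
    (G : SimpleGraph V) [DecidableRel G.Adj] {w : Finset V → ℝ}
    (hw : ∀ S ∈ indepSets G, 0 ≤ w S)
    (hcov : ∀ v, 1 ≤ ∑ S ∈ (indepSets G).filter (fun S => v ∈ S), w S)
    (hpos : 0 < ∑ S ∈ indepSets G, w S) :
    ∃ x : Finset V → ℝ, (∀ C ∈ vertexCovers G, 0 ≤ x C) ∧ ∑ C ∈ vertexCovers G, x C = 1 ∧
      ∀ v, ∑ C ∈ (vertexCovers G).filter (fun C => v ∈ C), x C =
        1 - 1 / ∑ S ∈ indepSets G, w S := by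
  obtain ⟨w', h0, ht, h1⟩ := exists_fracPartition_of_fracCover (M := indepSets G)
    (fun a S hS => mem_indepSets.mpr fun u hu v hv => mem_indepSets.mp hS u
      (Finset.mem_of_mem_erase hu) v (Finset.mem_of_mem_erase hv))
    hw Finset.univ fun v _ => hcov v
  have htot : ∑ C ∈ vertexCovers G, w' Cᶜ / ∑ S ∈ indepSets G, w S = 1 := by
    rw [sum_vertexCovers]
    simp only [compl_compl]
    rw [← Finset.sum_div, ht, div_self hpos.ne']
  refine ⟨fun C => w' Cᶜ / ∑ S ∈ indepSets G, w S,
    fun C hC => div_nonneg (h0 _ (compl_mem_indepSets.mpr hC)) hpos.le, htot, fun v => ?_⟩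
  rw [sum_vertexCovers_filter_mem, htot]
  simp only [compl_compl]
  rw [← Finset.sum_div, h1 v (Finset.mem_univ v)]

theorem fracChromaticNumber_le {V : Type*} [Fintype V] [DecidableEq V] (G : SimpleGraph V)
    [DecidableRel G.Adj] {w : Finset V → ℝ} (hw : ∀ S ∈ indepSets G, 0 ≤ w S)
    (hcov : ∀ v, 1 ≤ ∑ S ∈ (indepSets G).filter (fun S => v ∈ S), w S) :
    fracChromaticNumber G ≤ ∑ S ∈ indepSets G, w S := by
  refine csInf_le ⟨0, ?_⟩ ⟨w, hw, fun v _ => hcov v, rfl⟩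
  rintro _ ⟨w, hw, -, rfl⟩
  exact Finset.sum_nonneg hw

theorem le_fracChromaticNumber {V : Type*} [Fintype V] [DecidableEq V] (G : SimpleGraph V)
    [DecidableRel G.Adj] {r : ℝ} (h : ∀ w : Finset V → ℝ, (∀ S ∈ indepSets G, 0 ≤ w S) →
      (∀ v, 1 ≤ ∑ S ∈ (indepSets G).filter (fun S => v ∈ S), w S) →
      r ≤ ∑ S ∈ indepSets G, w S) :
    r ≤ fracChromaticNumber G := by
  refine le_csInf ⟨_, fun _ => 1, fun _ _ => zero_le_one, fun v _ => ?_, rfl⟩ ?_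
  · rw [Finset.sum_const, nsmul_one, Nat.one_le_cast]
    refine Finset.card_pos.mpr ⟨{v}, Finset.mem_filter.mpr ⟨mem_indepSets.mpr ?_, by simp⟩⟩
    simp
  · rintro _ ⟨w, hw, hcov, rfl⟩
    exact h w hw fun v => hcov v (Finset.mem_univ v)

theorem one_le_sum_of_cover {V : Type*} [Fintype V] [DecidableEq V] [Nonempty V]
    {M : Finset (Finset V)} {w : Finset V → ℝ} (hw : ∀ S ∈ M, 0 ≤ w S)
    (hcov : ∀ v, 1 ≤ ∑ S ∈ M.filter (fun S => v ∈ S), w S) : 1 ≤ ∑ S ∈ M, w S :=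
  (hcov (Classical.arbitrary V)).trans
    (Finset.sum_le_sum_of_subset_of_nonneg (Finset.filter_subset _ _) fun S hS _ => hw S hS)

theorem fracChromaticNumber_pos {V : Type*} [Fintype V] [DecidableEq V] [Nonempty V]
    (G : SimpleGraph V) [DecidableRel G.Adj] : 0 < fracChromaticNumber G :=
  one_pos.trans_le (le_fracChromaticNumber G fun _ hw hcov => one_le_sum_of_cover hw hcov)

/-- No distribution over vertex covers selects every vertex with probability below
`1 - 1 / χ_f(G)`. -/
theorem one_sub_inv_fracChromaticNumber_le {V : Type*} [Fintype V] [DecidableEq V] [Nonempty V]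
    (G : SimpleGraph V) [DecidableRel G.Adj] {x : Finset V → ℝ} {p : ℝ}
    (hx : ∀ C ∈ vertexCovers G, 0 ≤ x C) (hsum : ∑ C ∈ vertexCovers G, x C = 1)
    (hp : ∀ v, ∑ C ∈ (vertexCovers G).filter (fun C => v ∈ C), x C ≤ p) :
    1 - 1 / fracChromaticNumber G ≤ p := by
  have hχ := fracChromaticNumber_pos G
  rcases le_or_gt 1 p with h1 | h1
  · have := one_div_pos.mpr hχ
    linarith
  have hq : 0 < 1 - p := sub_pos.mpr h1
  have hle : fracChromaticNumber G ≤ 1 / (1 - p) := by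
    refine (fracChromaticNumber_le G (w := fun S => x Sᶜ / (1 - p))
      (fun S hS => div_nonneg (hx _ (compl_mem_vertexCovers.mpr hS)) hq.le) fun v => ?_).trans_eq ?_
    · rw [← Finset.sum_div, one_le_div hq]
      have := hp v
      rw [sum_vertexCovers_filter_mem, hsum] at this
      linarith
    · rw [← Finset.sum_div, ← sum_vertexCovers, hsum]
  have := (le_one_div hχ hq).mp hle
  linarith

/-- A lower bound for the exact selection probabilities of distributions over vertex covers is at
most `1 - 1 / χ_f(G)`. -/
theorem le_one_sub_inv_fracChromaticNumber {V : Type*} [Fintype V] [DecidableEq V] [Nonempty V]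
    (G : SimpleGraph V) [DecidableRel G.Adj] {r : ℝ}
    (h : ∀ (x : Finset V → ℝ) (p : ℝ), (∀ C ∈ vertexCovers G, 0 ≤ x C) →
      ∑ C ∈ vertexCovers G, x C = 1 →
      (∀ v, ∑ C ∈ (vertexCovers G).filter (fun C => v ∈ C), x C = p) → r ≤ p) :
    r ≤ 1 - 1 / fracChromaticNumber G := by
  have hχ := fracChromaticNumber_pos G
  have hr (w : Finset V → ℝ) (hw : ∀ S ∈ indepSets G, 0 ≤ w S)
      (hcov : ∀ v, 1 ≤ ∑ S ∈ (indepSets G).filter (fun S => v ∈ S), w S) :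
      0 < ∑ S ∈ indepSets G, w S ∧ 1 / ∑ S ∈ indepSets G, w S ≤ 1 - r := by
    have hpos := one_pos.trans_le (one_le_sum_of_cover hw hcov)
    obtain ⟨x, hx, hsum, hp⟩ := exists_uniform_vertexCover_distribution G hw hcov hpos
    exact ⟨hpos, le_sub_comm.mp (h x _ hx hsum hp)⟩
  have hr1 : 0 < 1 - r := by
    by_contra hr0
    have : fracChromaticNumber G + 1 ≤ fracChromaticNumber G :=
      le_fracChromaticNumber G fun w hw hcov =>
        absurd ((one_div_pos.mpr (hr w hw hcov).1).trans_le (hr w hw hcov).2) hr0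
    linarith
  have : 1 / (1 - r) ≤ fracChromaticNumber G := le_fracChromaticNumber G fun w hw hcov =>
    (one_div_le (hr w hw hcov).1 hr1).mp (hr w hw hcov).2
  exact le_sub_comm.mp ((one_div_le hr1 hχ).mp this)

/-- For a graph `G` on a nonempty vertex set, the minimum uniform fairness and minimum
Rawlsian justice values of the fair vertex cover system both equal `1 - 1 / χ_f(G)`. -/
theorem fairVertexCover_pUmin_eq_pRmin_eq_one_sub_inv_fracChromatic
    {V : Type*} [Fintype V] [DecidableEq V] [Nonempty V]
    (G : SimpleGraph V) [DecidableRel G.Adj] :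
    pUmin Finset.univ (vertexCovers G) = 1 - 1 / fracChromaticNumber G ∧
    pRmin Finset.univ (vertexCovers G) = 1 - 1 / fracChromaticNumber G := by
  have hlower (p : ℝ) (hp : ∃ x : Finset V → ℝ, (∀ m ∈ vertexCovers G, 0 ≤ x m) ∧
      (∑ m ∈ vertexCovers G, x m) = 1 ∧
      ∀ a ∈ Finset.univ, (∑ m ∈ (vertexCovers G).filter (fun m => a ∈ m), x m) ≤ p) :
      1 - 1 / fracChromaticNumber G ≤ p := by
    obtain ⟨x, hx, hsum, hp⟩ := hp
    exact one_sub_inv_fracChromaticNumber_le G hx hsum fun v => hp v (Finset.mem_univ v)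
  have hmem : ∃ p, ∃ x : Finset V → ℝ, (∀ m ∈ vertexCovers G, 0 ≤ x m) ∧
      (∑ m ∈ vertexCovers G, x m) = 1 ∧
      ∀ a ∈ Finset.univ, (∑ m ∈ (vertexCovers G).filter (fun m => a ∈ m), x m) = p := by
    by_contra hne
    have := le_one_sub_inv_fracChromaticNumber G (r := 1) fun x p hx hsum hp =>
      absurd ⟨p, x, hx, hsum, fun v _ => hp v⟩ hne
    have := one_div_pos.mpr (fracChromaticNumber_pos G)
    linarith
  constructor
  · refine le_antisymm ?_ (le_csInf hmem ?_)
    · refine le_one_sub_inv_fracChromaticNumber G fun x p hx hsum hp =>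
        csInf_le ⟨1 - 1 / fracChromaticNumber G, ?_⟩ ⟨x, hx, hsum, fun v _ => hp v⟩
      rintro q ⟨y, hy, hsum, hq⟩
      exact hlower q ⟨y, hy, hsum, fun v hv => (hq v hv).le⟩
    · rintro q ⟨y, hy, hsum, hq⟩
      exact hlower q ⟨y, hy, hsum, fun v hv => (hq v hv).le⟩
  · obtain ⟨p, x, hx, hsum, hp⟩ := hmem
    refine le_antisymm ?_ (le_csInf ⟨p, x, hx, hsum, fun v hv => (hp v hv).le⟩ hlower)
    exact le_one_sub_inv_fracChromaticNumber G fun x p hx hsum hp =>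
      csInf_le ⟨1 - 1 / fracChromaticNumber G, hlower⟩ ⟨x, hx, hsum, fun v _ => (hp v).le⟩
end

section
/- Let G = (V, E) be a finite simple graph with nonempty vertex set, and consider the set system (V, C) where C is the family of all cliques of G (including the empty set). Then p_U(V, C) = p_R(V, C) = 1 / χ_f(Ḡ), where Ḡ is the complement graph of G and χ_f(Ḡ) is its fractional vertex coloring number. -/
open Finset

/-- The family of all cliques of `G` (including the empty set). -/
noncomputable def cliqueSets {V : Type*} [Fintype V] [DecidableEq V]
    (G : SimpleGraph V) [DecidableRel G.Adj] : Finset (Finset V) :=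
  Finset.univ.powerset.filter (fun s => ∀ u ∈ s, ∀ v ∈ s, u ≠ v → G.Adj u v)

/-- Moving a fraction `1 - t` of the weight of each set `s` to `s.erase v`: the effect on sums. -/
theorem exists_weight_erase_s10 {α : Type*} [DecidableEq α] {M : Finset (Finset α)}
    (hM : IsLowerSet (M : Set (Finset α))) {x : Finset α → ℝ} (hx : ∀ m ∈ M, 0 ≤ x m)
    (v : α) {t : ℝ} (ht0 : 0 ≤ t) (ht1 : t ≤ 1) :
    ∃ y : Finset α → ℝ, (∀ m ∈ M, 0 ≤ y m) ∧ ∀ f : Finset α → ℝ,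
      ∑ m ∈ M, y m * f m = ∑ s ∈ M, x s * (t * f s + (1 - t) * f (s.erase v)) := by
  refine ⟨fun m => ∑ s ∈ M, x s * (t * (if m = s then 1 else 0) +
    (1 - t) * (if m = s.erase v then 1 else 0)), fun m _ => ?_, fun f => ?_⟩
  · refine Finset.sum_nonneg fun s hs => mul_nonneg (hx s hs) (add_nonneg ?_ ?_)
    · exact mul_nonneg ht0 (by split_ifs <;> norm_num)
    · exact mul_nonneg (sub_nonneg.2 ht1) (by split_ifs <;> norm_num)
  · simp only [Finset.sum_mul]
    rw [Finset.sum_comm]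
    refine Finset.sum_congr rfl fun s hs => ?_
    have hse : s.erase v ∈ M := hM (Finset.erase_subset v s) hs
    simp only [mul_assoc, add_mul, ← Finset.mul_sum, Finset.sum_add_distrib, ite_mul, one_mul,
      zero_mul, Finset.sum_ite_eq', hs, hse, if_true]

/-- In a down-closed family, a distribution covering every `a ∈ A` with weight at least `p ≥ 0`
can be trimmed to cover every `a ∈ A` with weight exactly `p`. -/
theorem exists_uniform_of_le_s10 {α : Type*} [DecidableEq α] {A : Finset α} {M : Finset (Finset α)}
    (hM : IsLowerSet (M : Set (Finset α))) {x : Finset α → ℝ} (hx : ∀ m ∈ M, 0 ≤ x m)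
    {p : ℝ} (hp : 0 ≤ p) (hxp : ∀ a ∈ A, p ≤ ∑ m ∈ M.filter (fun m => a ∈ m), x m) :
    ∃ y : Finset α → ℝ, (∀ m ∈ M, 0 ≤ y m) ∧ ∑ m ∈ M, y m = ∑ m ∈ M, x m ∧
      ∀ a ∈ A, ∑ m ∈ M.filter (fun m => a ∈ m), y m = p := by
  suffices H : ∀ T ⊆ A, ∃ y : Finset α → ℝ, (∀ m ∈ M, 0 ≤ y m) ∧
      ∑ m ∈ M, y m = ∑ m ∈ M, x m ∧
      (∀ a ∈ T, ∑ m ∈ M.filter (fun m => a ∈ m), y m = p) ∧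
      ∀ a ∈ A, p ≤ ∑ m ∈ M.filter (fun m => a ∈ m), y m by
    obtain ⟨y, hy, hsum, hyp, -⟩ := H A subset_rfl
    exact ⟨y, hy, hsum, hyp⟩
  intro T
  induction T using Finset.induction_on with
  | empty => exact fun _ => ⟨x, hx, rfl, by simp, hxp⟩
  | insert v T hv ih =>
    intro hT
    obtain ⟨y, hy, hsum, hyT, hyA⟩ := ih ((Finset.subset_insert v T).trans hT)
    have hpv := hyA v (hT (Finset.mem_insert_self v T))
    set c := ∑ m ∈ M.filter (fun m => v ∈ m), y m with hc
    have hc0 : 0 ≤ c := hp.trans hpv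
    have htc : p / c * c = p := div_mul_cancel_of_imp fun h => le_antisymm (h ▸ hpv) hp
    obtain ⟨z, hz, hzf⟩ := exists_weight_erase_s10 hM hy v (div_nonneg hp hc0)
      (div_le_one_of_le₀ hpv hc0)
    have hzv : ∑ m ∈ M.filter (fun m => v ∈ m), z m = p := by
      have h := hzf fun m => if v ∈ m then 1 else 0
      simp only [Finset.notMem_erase, if_false, mul_zero, add_zero, mul_ite, mul_one,
        ← Finset.sum_filter, ← Finset.sum_mul, ← hc] at h
      rw [h, mul_comm, htc]
    have hza : ∀ a, a ≠ v → ∑ m ∈ M.filter (fun m => a ∈ m), z m =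
        ∑ m ∈ M.filter (fun m => a ∈ m), y m := by
      intro a ha
      have h := hzf fun m => if a ∈ m then 1 else 0
      simp only [Finset.mem_erase, ne_eq, ha, not_false_eq_true, true_and, ← add_mul,
        add_sub_cancel, one_mul] at h
      simp only [mul_ite, mul_one, mul_zero, ← Finset.sum_filter] at h
      exact h
    refine ⟨z, hz, ?_, fun a ha => ?_, fun a ha => ?_⟩
    · simpa [hsum] using hzf fun _ => 1
    · rcases Finset.mem_insert.1 ha with rfl | haT
      · exact hzv
      · rw [hza a (ne_of_mem_of_not_mem haT hv), hyT a haT]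
    · rcases eq_or_ne a v with rfl | hav
      · exact hzv.ge
      · exact (hyA a ha).trans_eq (hza a hav).symm

/-- A Rawlsian value is at most `1`. -/
theorem le_one_of_forall_le_sum_filter {α : Type*} [DecidableEq α] {A : Finset α}
    {M : Finset (Finset α)} (hA : A.Nonempty) {x : Finset α → ℝ} (hx : ∀ m ∈ M, 0 ≤ x m)
    (hsum : ∑ m ∈ M, x m = 1) {p : ℝ}
    (hxp : ∀ a ∈ A, p ≤ ∑ m ∈ M.filter (fun m => a ∈ m), x m) : p ≤ 1 := by
  obtain ⟨a, ha⟩ := hA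
  exact hsum ▸ (hxp a ha).trans (Finset.sum_le_sum_of_subset_of_nonneg
    (Finset.filter_subset _ _) fun m hm _ => hx m hm)

/-- In a down-closed family, uniform fairness costs nothing over Rawlsian justice. -/
theorem pU_eq_pR {α : Type*} [DecidableEq α] {A : Finset α} {M : Finset (Finset α)}
    (hM : IsLowerSet (M : Set (Finset α))) (hM' : ∅ ∈ M) :
    pU A M = pR A M := by
  have hzero : ∃ x : Finset α → ℝ, (∀ m ∈ M, 0 ≤ x m) ∧ (∑ m ∈ M, x m) = 1 ∧
      ∀ a ∈ A, (∑ m ∈ M.filter (fun m => a ∈ m), x m) = 0 :=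
    ⟨fun m => if m = ∅ then 1 else 0, fun m _ => by dsimp only; split_ifs <;> norm_num,
      by simp [hM'], fun a _ => by simp⟩
  refine csSup_eq_csSup_of_forall_exists_le ?_ ?_
  · rintro p ⟨x, hx, hsum, hxp⟩
    exact ⟨p, ⟨x, hx, hsum, fun a ha => (hxp a ha).ge⟩, le_rfl⟩
  · rintro p ⟨x, hx, hsum, hxp⟩
    rcases le_total p 0 with hp | hp
    · exact ⟨0, hzero, hp⟩
    · obtain ⟨y, hy, hysum, hyp⟩ := exists_uniform_of_le_s10 hM hx hp hxp
      exact ⟨p, ⟨y, hy, hysum.trans hsum, hyp⟩, le_rfl⟩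

/-- Rescaling exchanges Rawlsian distributions and fractional covers. -/
theorem pR_eq_one_div_fracCovNum {α : Type*} [DecidableEq α] {A : Finset α}
    {M : Finset (Finset α)} (hA : A.Nonempty) (hcov : ∀ a ∈ A, ∃ m ∈ M, a ∈ m) :
    pR A M = 1 / fracCovNum A M := by
  unfold pR fracCovNum
  set R := {p : ℝ | ∃ x : Finset α → ℝ, (∀ m ∈ M, 0 ≤ x m) ∧ (∑ m ∈ M, x m) = 1 ∧
    ∀ a ∈ A, p ≤ (∑ m ∈ M.filter (fun m => a ∈ m), x m)}
  set K := {s : ℝ | ∃ w : Finset α → ℝ, (∀ m ∈ M, 0 ≤ w m) ∧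
    (∀ a ∈ A, 1 ≤ (∑ m ∈ M.filter (fun m => a ∈ m), w m)) ∧ s = ∑ m ∈ M, w m}
  have hK_one : ∀ s ∈ K, 1 ≤ s := by
    rintro s ⟨w, hw, hw1, rfl⟩
    obtain ⟨a, ha⟩ := hA
    exact (hw1 a ha).trans (Finset.sum_le_sum_of_subset_of_nonneg
      (Finset.filter_subset _ _) fun m hm _ => hw m hm)
  have hK_ne : K.Nonempty := by
    refine ⟨_, fun _ => 1, fun _ _ => zero_le_one, fun a ha => ?_, rfl⟩
    obtain ⟨m, hm, ham⟩ := hcov a ha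
    exact Finset.single_le_sum (f := fun _ => (1 : ℝ)) (fun _ _ => zero_le_one)
      (Finset.mem_filter.2 ⟨hm, ham⟩)
  have hR_bdd : BddAbove R := by
    refine ⟨1, ?_⟩
    rintro p ⟨x, hx, hsum, hxp⟩
    exact le_one_of_forall_le_sum_filter hA hx hsum hxp
  have hKR : ∀ s ∈ K, 1 / s ∈ R := by
    intro s hs
    have hs0 : 0 < s := one_pos.trans_le (hK_one s hs)
    obtain ⟨w, hw, hw1, hws⟩ := hs
    refine ⟨fun m => w m / s, fun m hm => div_nonneg (hw m hm) hs0.le, ?_, fun a ha => ?_⟩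
    · rw [← Finset.sum_div, ← hws, div_self hs0.ne']
    · rw [← Finset.sum_div]
      exact div_le_div_of_nonneg_right (hw1 a ha) hs0.le
  have hk : 0 < sInf K := one_pos.trans_le (le_csInf hK_ne hK_one)
  obtain ⟨s₀, hs₀⟩ := hK_ne
  refine le_antisymm (csSup_le ⟨_, hKR s₀ hs₀⟩ fun p hpR => ?_) ?_
  · rcases le_or_gt p 0 with hp | hp
    · exact hp.trans (one_div_pos.2 hk).le
    · obtain ⟨x, hx, hsum, hxp⟩ := hpR
      refine (le_one_div hp hk).2 (csInf_le ⟨1, hK_one⟩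
        ⟨fun m => x m / p, fun m hm => div_nonneg (hx m hm) hp.le, fun a ha => ?_, ?_⟩)
      · rw [← Finset.sum_div, one_le_div hp]
        exact hxp a ha
      · rw [← Finset.sum_div, hsum]
  · have hpos : 0 < sSup R := (one_div_pos.2 (one_pos.trans_le (hK_one s₀ hs₀))).trans_le
      (le_csSup hR_bdd (hKR s₀ hs₀))
    refine (one_div_le hpos hk).1 (le_csInf ⟨s₀, hs₀⟩ fun s hs => ?_)
    exact (one_div_le (one_pos.trans_le (hK_one s hs)) hpos).1 (le_csSup hR_bdd (hKR s hs))

theorem cliqueSets_eq_indepSets_compl {V : Type*} [Fintype V] [DecidableEq V]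
    (G : SimpleGraph V) [DecidableRel G.Adj] [DecidableRel Gᶜ.Adj] :
    cliqueSets G = indepSets Gᶜ := by
  ext s
  simp only [cliqueSets, indepSets, Finset.mem_filter, SimpleGraph.compl_adj]
  grind

theorem isLowerSet_cliqueSets {V : Type*} [Fintype V] [DecidableEq V]
    (G : SimpleGraph V) [DecidableRel G.Adj] :
    IsLowerSet (cliqueSets G : Set (Finset V)) := by
  intro s t hts hs
  simp only [cliqueSets, Finset.coe_filter, Set.mem_ofPred_eq] at hs ⊢
  exact ⟨by simp, fun u hu v hv => hs.2 u (hts hu) v (hts hv)⟩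

theorem empty_mem_cliqueSets {V : Type*} [Fintype V] [DecidableEq V]
    (G : SimpleGraph V) [DecidableRel G.Adj] : ∅ ∈ cliqueSets G := by
  simp [cliqueSets]

theorem singleton_mem_cliqueSets {V : Type*} [Fintype V] [DecidableEq V]
    (G : SimpleGraph V) [DecidableRel G.Adj] (v : V) : {v} ∈ cliqueSets G := by
  simp [cliqueSets]

open Classical in
/-- For a graph `G` on a nonempty vertex set, the uniform fairness and Rawlsian
justice values of the fair clique system both equal `1 / χ_f(Ḡ)`, where `Ḡ` is the
complement graph of `G`. -/
theorem fairClique_pU_eq_pR_eq_inv_fracChromatic_compl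
    {V : Type*} [Fintype V] [DecidableEq V] [Nonempty V]
    (G : SimpleGraph V) [DecidableRel G.Adj] :
    pU Finset.univ (cliqueSets G) = 1 / fracChromaticNumber Gᶜ ∧
    pR Finset.univ (cliqueSets G) = 1 / fracChromaticNumber Gᶜ := by
  have hR : pR Finset.univ (cliqueSets G) = 1 / fracChromaticNumber Gᶜ := by
    rw [pR_eq_one_div_fracCovNum Finset.univ_nonempty
      fun a _ => ⟨{a}, singleton_mem_cliqueSets G a, Finset.mem_singleton_self a⟩,
      fracChromaticNumber, cliqueSets_eq_indepSets_compl]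
  exact ⟨(pU_eq_pR (isLowerSet_cliqueSets G)
    (empty_mem_cliqueSets G)).trans hR, hR⟩
end

section
/- Let G = (V, E) be a finite simple bipartite graph with no isolated vertices, and consider the set system (V, V(M)) where V(M) is the family of vertex sets covered by matchings of G. If G contains no perfect matching, then p_U(V, V(M)) = 0. -/
open Finset

/-- The family `V(M)` of vertex sets covered by matchings of `G`. -/
noncomputable def coveredSets {V : Type*} [Fintype V] [DecidableEq V]
    (G : SimpleGraph V) [DecidableRel G.Adj] : Finset (Finset V) :=
  (matchings G).image (fun m => Finset.univ.filter (fun v => ∃ e ∈ m, v ∈ e))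

/-- In a graph properly coloured with two colours, an injective choice of neighbours yields a
perfect matching. -/
theorem exists_perfect_mem_matchings {V : Type*} [Fintype V] [DecidableEq V]
    (G : SimpleGraph V) [DecidableRel G.Adj] {f : V → Bool}
    (hf : ∀ u v : V, G.Adj u v → f u ≠ f v) {g : V → V} (hg : Function.Injective g)
    (hadj : ∀ v, G.Adj v (g v)) :
    ∃ m ∈ matchings G, ∀ v : V, ∃ e ∈ m, v ∈ e := by
  refine ⟨(univ.filter (fun v => f v = true)).image (fun v => s(v, g v)), ?_, fun v => ?_⟩
  · simp only [matchings, mem_filter, mem_powerset]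
    constructor
    · intro e he
      obtain ⟨v, -, rfl⟩ := mem_image.1 he
      simpa using hadj v
    · intro e he e' he' hne w hw
      obtain ⟨v, hv, rfl⟩ := mem_image.1 he
      obtain ⟨u, hu, rfl⟩ := mem_image.1 he'
      have hv' := (mem_filter.1 hv).2
      have hu' := (mem_filter.1 hu).2
      have hfv := hf _ _ (hadj v)
      have hfu := hf _ _ (hadj u)
      have huv : v ≠ u := by rintro rfl; exact hne rfl
      obtain ⟨h₁, h₂⟩ := hw
      rcases Sym2.mem_iff.1 h₁ with rfl | rfl <;> rcases Sym2.mem_iff.1 h₂ with h | h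
      · exact huv h
      · rw [← h, hu', hv'] at hfu; exact hfu rfl
      · rw [h, hu', hv'] at hfv; exact hfv rfl
      · exact huv (hg h)
  · cases hv : f v with
    | true => exact ⟨s(v, g v), mem_image.2 ⟨v, by simp [hv], rfl⟩, by simp⟩
    | false =>
      obtain ⟨u, rfl⟩ := (Finite.injective_iff_surjective.1 hg) v
      have hfu := hf _ _ (hadj u)
      rw [hv] at hfu
      exact ⟨s(u, g u), mem_image.2 ⟨u, by simpa using hfu, rfl⟩, by simp⟩

/-- A set covered by a matching meets `S` in at most as many vertices as the neighbourhood
of `S`. -/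
theorem card_inter_le_card_neighbors_inter {V : Type*} [Fintype V] [DecidableEq V]
    (G : SimpleGraph V) [DecidableRel G.Adj] (S T : Finset V) (hT : T ∈ coveredSets G) :
    (S.filter (fun v => v ∈ T)).card ≤
      ((univ.filter (fun w => ∃ v ∈ S, G.Adj v w)).filter (fun w => w ∈ T)).card := by
  obtain ⟨m, hm, rfl⟩ := mem_image.1 hT
  simp only [matchings, mem_filter, mem_powerset] at hm
  obtain ⟨hsub, hdisj⟩ := hm
  have partner : ∀ v, (∃ e ∈ m, v ∈ e) → ∃ w, s(v, w) ∈ m := by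
    rintro v ⟨e, he, hve⟩
    obtain ⟨w, rfl⟩ := Sym2.mem_iff_exists.1 hve
    exact ⟨w, he⟩
  refine card_le_card_of_forall_subsingleton (fun v w => s(v, w) ∈ m) ?_ ?_
  · intro v hv
    simp only [mem_filter, mem_univ, true_and] at hv
    obtain ⟨w, hw⟩ := partner v hv.2
    have hadj : G.Adj v w := by simpa using hsub hw
    refine ⟨w, ?_, hw⟩
    simp only [mem_filter, mem_univ, true_and]
    exact ⟨⟨v, hv.1, hadj⟩, s(v, w), hw, by simp⟩
  · rintro w - v ⟨-, hv⟩ u ⟨-, hu⟩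
    by_contra hne
    exact hdisj _ hv _ hu (fun h => hne (Sym2.congr_left.1 h)) w ⟨by simp, by simp⟩

/-- Double counting: summing the coverage of the elements of `S` weights each member of the
family by the size of its intersection with `S`. -/
theorem sum_sum_filter_mem {α : Type*} [DecidableEq α] (M : Finset (Finset α))
    (x : Finset α → ℝ) (S : Finset α) :
    ∑ a ∈ S, ∑ T ∈ M.filter (fun T => a ∈ T), x T =
      ∑ T ∈ M, ((S.filter (fun a => a ∈ T)).card : ℝ) * x T := by
  simp only [sum_filter]
  rw [sum_comm]
  refine sum_congr rfl fun T _ => ?_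
  rw [← sum_filter, sum_const, nsmul_eq_mul]

/-- If a bipartite graph `G` without isolated vertices has no perfect matching, then
the uniform fairness value of the fair matching for vertices set system is `0`. -/
theorem bipartite_pU_eq_zero_of_no_perfectMatching
    {V : Type*} [Fintype V] [DecidableEq V]
    (G : SimpleGraph V) [DecidableRel G.Adj]
    (hiso : ∀ v : V, ∃ u : V, G.Adj v u)
    (hbip : ∃ f : V → Bool, ∀ u v : V, G.Adj u v → f u ≠ f v)
    (hpm : ¬ ∃ m ∈ matchings G, ∀ v : V, ∃ e ∈ m, v ∈ e) :
    pU Finset.univ (coveredSets G) = 0 := by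
  obtain ⟨f, hf⟩ := hbip
  obtain ⟨S, hS⟩ : ∃ S : Finset V, (univ.filter (fun w => ∃ v ∈ S, G.Adj v w)).card < S.card := by
    by_contra! hall
    obtain ⟨g, hg, hadj⟩ :=
      (Fintype.all_card_le_filter_rel_iff_exists_injective G.Adj).1 hall
    exact hpm (exists_perfect_mem_matchings G hf hg hadj)
  have hne : S.Nonempty := card_pos.1 (by omega)
  refine le_antisymm (Real.sSup_le ?_ le_rfl) (Real.sSup_nonneg ?_)
  · rintro p ⟨x, hx, -, hp⟩
    have key : ∀ U : Finset V, (U.card : ℝ) * p =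
        ∑ T ∈ coveredSets G, ((U.filter (fun a => a ∈ T)).card : ℝ) * x T := fun U => by
      rw [← sum_sum_filter_mem, sum_congr rfl fun a _ => hp a (mem_univ a), sum_const,
        nsmul_eq_mul]
    have hle : (S.card : ℝ) * p ≤
        ((univ.filter (fun w => ∃ v ∈ S, G.Adj v w)).card : ℝ) * p := by
      rw [key, key]
      refine sum_le_sum fun T hT => mul_le_mul_of_nonneg_right ?_ (hx T hT)
      exact_mod_cast card_inter_le_card_neighbors_inter G S T hT
    exact not_lt.1 fun hp0 => hle.not_gt (mul_lt_mul_of_pos_right (by exact_mod_cast hS) hp0)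
  · rintro p ⟨x, hx, -, hp⟩
    obtain ⟨a, -⟩ := hne
    rw [← hp a (mem_univ a)]
    exact sum_nonneg fun T hT => hx T (mem_filter.1 hT).1
end

section
/- Let G = (V, E) be a finite simple graph with no isolated vertices that is not regular, and consider the set system (V, V(M)) where V(M) is the family of vertex sets covered by matchings of G. Then p_R(V, V(M)) ≥ 1 / (Δ(G) − δ(G) + 1), where Δ(G) and δ(G) denote the maximum and minimum degree of G, respectively. -/
open Finset

/-- If `f` maps each vertex of `D` injectively to a neighbour and no nonempty subset of `D` is
contained in its image under `f`, then some matching inside `D ∪ f(D)` covers `D`. -/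
theorem exists_matching_covering_of_injOn {V : Type*} [Fintype V] [DecidableEq V]
    (G : SimpleGraph V) [DecidableRel G.Adj] (f : V → V) (D : Finset V)
    (hadj : ∀ v ∈ D, G.Adj v (f v)) (hinj : Set.InjOn f D)
    (hacyc : ∀ D' ⊆ D, D'.Nonempty → ∃ v ∈ D', v ∉ D'.image f) :
    ∃ m ∈ matchings G, (∀ e ∈ m, ∀ v ∈ e, v ∈ D ∪ D.image f) ∧
      ∀ v ∈ D, ∃ e ∈ m, v ∈ e := by
  induction D using Finset.strongInduction with
  | H D ih =>
    rcases D.eq_empty_or_nonempty with rfl | hD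
    · exact ⟨∅, by simp [matchings], by simp, by simp⟩
    · obtain ⟨v, hv, hvf⟩ := hacyc D subset_rfl hD
      have hsub : (D.erase v).erase (f v) ⊆ D :=
        (Finset.erase_subset _ _).trans (Finset.erase_subset _ _)
      have hmem : ∀ w ∈ (D.erase v).erase (f v), w ∈ D ∧ w ≠ v ∧ w ≠ f v := by
        intro w hw
        simp only [Finset.mem_erase] at hw
        tauto
      obtain ⟨m, hm, hmD, hcov⟩ := ih _
        (Finset.ssubset_iff_subset_ne.2 ⟨hsub, fun h => (hmem v (h.symm.subset hv)).2.1 rfl⟩)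
        (fun w hw => hadj w (hsub hw)) (hinj.mono (by exact_mod_cast hsub))
        (fun D' hD' => hacyc D' (hD'.trans hsub))
      have havoid : ∀ e ∈ m, v ∉ e ∧ f v ∉ e := by
        have key : ∀ w ∈ (D.erase v).erase (f v) ∪ ((D.erase v).erase (f v)).image f,
            w ≠ v ∧ w ≠ f v := by
          intro w hw
          rcases Finset.mem_union.1 hw with hw | hw
          · exact (hmem w hw).2
          · obtain ⟨z, hz, rfl⟩ := Finset.mem_image.1 hw
            obtain ⟨hzD, hzv, -⟩ := hmem z hz
            exact ⟨fun h => hvf (Finset.mem_image.2 ⟨z, hzD, h⟩),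
              fun h => hzv (hinj hzD hv h)⟩
        exact fun e he => ⟨fun h => (key _ (hmD e he _ h)).1 rfl,
          fun h => (key _ (hmD e he _ h)).2 rfl⟩
      simp only [matchings, Finset.mem_filter, Finset.mem_powerset] at hm
      refine ⟨insert s(v, f v) m, ?_, ?_, ?_⟩
      · simp only [matchings, Finset.mem_filter, Finset.mem_powerset]
        refine ⟨Finset.insert_subset (by simpa using hadj v hv) hm.1, ?_⟩
        intro e hem e' hem' hne w hw
        rcases Finset.mem_insert.1 hem with rfl | he <;>
          rcases Finset.mem_insert.1 hem' with rfl | he'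
        · exact hne rfl
        · rcases Sym2.mem_iff.1 hw.1 with rfl | rfl
          · exact (havoid e' he').1 hw.2
          · exact (havoid e' he').2 hw.2
        · rcases Sym2.mem_iff.1 hw.2 with rfl | rfl
          · exact (havoid e he).1 hw.1
          · exact (havoid e he).2 hw.1
        · exact hm.2 e he e' he' hne w hw
      · intro e he w hw
        rcases Finset.mem_insert.1 he with rfl | he
        · rcases Sym2.mem_iff.1 hw with rfl | rfl
          · exact Finset.mem_union_left _ hv
          · exact Finset.mem_union_right _ (Finset.mem_image_of_mem f hv)
        · exact Finset.union_subset_union hsub (Finset.image_subset_image hsub) (hmD e he w hw)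
      · intro w hw
        by_cases h1 : w = v
        · exact ⟨s(v, f v), by simp, by simp [h1]⟩
        by_cases h2 : w = f v
        · exact ⟨s(v, f v), by simp, by simp [h2]⟩
        obtain ⟨e, he, hwe⟩ := hcov w (by simp [h1, h2, hw])
        exact ⟨e, Finset.mem_insert_of_mem he, hwe⟩

/-- If `k` times the minimum degree is at least the maximum degree, one can assign to each vertex
a neighbour and one of `k` colours so that the pairs are distinct. -/
theorem exists_injective_neighbor_color {V : Type*} [Fintype V] [DecidableEq V]
    (G : SimpleGraph V) [DecidableRel G.Adj] (k : ℕ) (hpos : 0 < G.minDegree)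
    (hk : G.maxDegree ≤ k * G.minDegree) :
    ∃ g : V → V × Fin k, Function.Injective g ∧ ∀ v, G.Adj v (g v).1 := by
  have hall := (Finset.all_card_le_biUnion_card_iff_exists_injective
    (fun v => G.neighborFinset v ×ˢ (Finset.univ : Finset (Fin k)))).1 ?_
  · obtain ⟨g, hg, hg'⟩ := hall
    exact ⟨g, hg, fun v => by simpa using hg' v⟩
  · intro X
    have hprod : X.biUnion (fun v => G.neighborFinset v ×ˢ (Finset.univ : Finset (Fin k))) =
        X.biUnion (fun v => G.neighborFinset v) ×ˢ (Finset.univ : Finset (Fin k)) := by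
      ext ⟨a, b⟩
      simp
    rw [hprod, Finset.card_product, Finset.card_univ, Fintype.card_fin]
    have hcount : X.card * G.minDegree ≤
        (X.biUnion (fun v => G.neighborFinset v)).card * G.maxDegree := by
      refine Finset.card_mul_le_card_mul G.Adj (fun v hv => ?_) (fun u _ => ?_)
      · refine (G.minDegree_le_degree v).trans ?_
        rw [← G.card_neighborFinset_eq_degree]
        refine Finset.card_le_card fun u hu => ?_
        simp only [Finset.mem_bipartiteAbove, Finset.mem_biUnion]
        exact ⟨⟨v, hv, hu⟩, by simpa using hu⟩
      · refine le_trans ?_ (G.degree_le_maxDegree u)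
        rw [← G.card_neighborFinset_eq_degree]
        refine Finset.card_le_card fun v hv => ?_
        simpa using ((Finset.mem_bipartiteBelow _).1 hv).2.symm
    refine Nat.le_of_mul_le_mul_right (hcount.trans ?_) hpos
    rw [mul_assoc]
    exact Nat.mul_le_mul_left _ hk

/-- A finite set contained in its image under `f` consists of periodic points of `f`. -/
theorem mem_periodicPts_of_subset_image {V : Type*} [DecidableEq V] (f : V → V) (D : Finset V)
    (hD : D ⊆ D.image f) {v : V} (hv : v ∈ D) : v ∈ Function.periodicPts f := by
  have himage : D.image f = D := (Finset.eq_of_subset_of_card_le hD Finset.card_image_le).symm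
  have hmaps : Set.MapsTo f D D := fun w hw => by
    have := Finset.mem_image_of_mem f hw
    rwa [himage] at this
  have hinj : Function.Injective (hmaps.restrict f D D) :=
    (Set.injOn_iff_injective.1 (Finset.card_image_iff.1 (congrArg Finset.card himage))).codRestrict
      _
  obtain ⟨n, hn, hper⟩ := hinj.mem_periodicPts ⟨v, hv⟩
  refine ⟨n, hn, ?_⟩
  have := congrArg Subtype.val hper
  rwa [hmaps.iterate_restrict, Set.MapsTo.val_restrict_apply] at this

/-- An injective assignment of pairs (neighbour, colour) with at least two colours yields one
matching for each colour, such that together they cover all vertices. -/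
theorem exists_matchings_covering {V : Type*} [Fintype V] [DecidableEq V]
    (G : SimpleGraph V) [DecidableRel G.Adj] {k : ℕ} (hk : 2 ≤ k) (g : V → V × Fin k)
    (hg : Function.Injective g) (hadj : ∀ v, G.Adj v (g v).1) :
    ∃ m : Fin k → Finset (Sym2 V), (∀ i, m i ∈ matchings G) ∧ ∀ v, ∃ i, ∃ e ∈ m i, v ∈ e := by
  classical
  let r := Fintype.equivFin V
  let f : V → V := fun v => (g v).1
  let target : V → Fin k := fun v => if r v < r (f v) then ⟨0, by lia⟩ else ⟨1, by lia⟩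
  have hperm : ∀ u, ∃ σ : Equiv.Perm (Fin k),
      ∀ v ∈ Function.periodicPts f, f v = u → σ (g v).2 = target v := by
    intro u
    by_cases h : ∃ v ∈ Function.periodicPts f, f v = u
    · obtain ⟨v, hv, rfl⟩ := h
      refine ⟨Equiv.swap (g v).2 (target v), fun w hw hwv => ?_⟩
      obtain rfl : w = v := (Function.bijOn_periodicPts f).injOn hw hv hwv
      exact Equiv.swap_apply_left _ _
    · exact ⟨1, fun v hv hvu => (h ⟨v, hv, hvu⟩).elim⟩
  choose σ hσ using hperm
  let c : V → Fin k := fun v => σ (f v) (g v).2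
  have hclass : ∀ i, ∃ m ∈ matchings G, ∀ v, c v = i → ∃ e ∈ m, v ∈ e := by
    intro i
    suffices h : ∃ m ∈ matchings G,
        (∀ e ∈ m, ∀ v ∈ e, v ∈ univ.filter (fun v => c v = i) ∪
          (univ.filter (fun v => c v = i)).image f) ∧
        ∀ v ∈ univ.filter (fun v => c v = i), ∃ e ∈ m, v ∈ e by
      obtain ⟨m, hm, -, hcov⟩ := h
      exact ⟨m, hm, fun v hv => hcov v (by simpa using hv)⟩
    refine exists_matching_covering_of_injOn G f _ (fun v _ => hadj v) ?_ ?_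
    · intro v hv w hw hvw
      have hcv : c v = i := by simpa using hv
      have hcw : c w = i := by simpa using hw
      refine hg (Prod.ext hvw ((σ (f v)).injective ?_))
      change c v = σ (f v) (g w).2
      rw [hcv, hvw, ← hcw]
    · intro D hD hne
      by_contra! hsub
      have himage : D.image f = D :=
        (Finset.eq_of_subset_of_card_le hsub Finset.card_image_le).symm
      have hmaps : ∀ v ∈ D, f v ∈ D := fun v hv => by
        have := Finset.mem_image_of_mem f hv
        rwa [himage] at this
      have htarget : ∀ v ∈ D, target v = i := fun v hv => by
        rw [← hσ (f v) v (mem_periodicPts_of_subset_image f D hsub hv) rfl]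
        simpa using hD hv
      obtain ⟨a, ha, hamax⟩ := D.exists_max_image r hne
      obtain ⟨b, hb, hbmin⟩ := D.exists_min_image r hne
      have hta : target a = ⟨1, by lia⟩ := if_neg (not_lt.2 (hamax _ (hmaps a ha)))
      have htb : target b = ⟨0, by lia⟩ := if_pos (lt_of_le_of_ne (hbmin _ (hmaps b hb))
        fun h => (hadj b).ne (r.injective h))
      rw [htarget a ha, ← htarget b hb, htb] at hta
      simp at hta
  choose m hm hcov using hclass
  exact ⟨m, hm, fun v => ⟨c v, hcov (c v) v rfl⟩⟩

/-- If `k` members of a set system together cover a nonempty ground set, its Rawlsian justice value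
is at least `1 / k`. -/
theorem one_div_le_pR_of_cover {α : Type*} [DecidableEq α] (A : Finset α) (M : Finset (Finset α))
    (hA : A.Nonempty) {k : ℕ} (hk : 0 < k) (S : Fin k → Finset α) (hS : ∀ i, S i ∈ M)
    (hcov : ∀ a ∈ A, ∃ i, a ∈ S i) : 1 / (k : ℝ) ≤ pR A M := by
  have hk' : (k : ℝ) ≠ 0 := by positivity
  refine le_csSup ?_ ?_
  · refine ⟨1, ?_⟩
    rintro p ⟨x, hx, hsum, hp⟩
    obtain ⟨a, ha⟩ := hA
    refine (hp a ha).trans (hsum ▸ ?_)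
    exact Finset.sum_le_sum_of_subset_of_nonneg (Finset.filter_subset _ _) fun m hm _ => hx m hm
  · refine ⟨fun s => ∑ i, if S i = s then 1 / (k : ℝ) else 0, fun s _ => ?_, ?_, fun a ha => ?_⟩
    · exact Finset.sum_nonneg fun i _ => by positivity
    · rw [Finset.sum_comm]
      simp [hS, hk']
    · obtain ⟨i, hi⟩ := hcov a ha
      have hmem : S i ∈ M.filter (fun m => a ∈ m) := Finset.mem_filter.2 ⟨hS i, hi⟩
      have hnonneg : ∀ s j, (0 : ℝ) ≤ if S j = s then 1 / (k : ℝ) else 0 := fun s j => by positivity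
      calc 1 / (k : ℝ) = if S i = S i then 1 / (k : ℝ) else 0 := by simp
        _ ≤ ∑ j, if S j = S i then 1 / (k : ℝ) else 0 :=
          Finset.single_le_sum (f := fun j => if S j = S i then 1 / (k : ℝ) else 0)
            (fun j _ => hnonneg _ j) (Finset.mem_univ i)
        _ ≤ _ := Finset.single_le_sum (f := fun s => ∑ j, if S j = s then 1 / (k : ℝ) else 0)
            (fun s _ => Finset.sum_nonneg fun j _ => hnonneg s j) hmem

/-- For a non-regular graph `G` without isolated vertices, the Rawlsian justice value
of the fair matching for vertices set system is at least `1 / (Δ(G) - δ(G) + 1)`. -/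
theorem nonregular_pR_ge_inv_degree_gap
    {V : Type*} [Fintype V] [DecidableEq V]
    (G : SimpleGraph V) [DecidableRel G.Adj]
    (hiso : ∀ v : V, ∃ u : V, G.Adj v u)
    (hnreg : ¬ ∃ d : ℕ, G.IsRegularOfDegree d) :
    1 / ((G.maxDegree : ℝ) - (G.minDegree : ℝ) + 1) ≤ pR Finset.univ (coveredSets G) := by
  have hne : Nonempty V := by
    by_contra h
    rw [not_nonempty_iff] at h
    exact hnreg ⟨0, fun v => h.elim v⟩
  have hlt : G.minDegree < G.maxDegree := by
    by_contra! h
    exact hnreg ⟨G.minDegree, fun v =>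
      le_antisymm ((G.degree_le_maxDegree v).trans h) (G.minDegree_le_degree v)⟩
  have hpos : 0 < G.minDegree := by
    obtain ⟨v, hv⟩ := G.exists_minimal_degree_vertex
    rw [hv]
    exact (G.degree_pos_iff_exists_adj v).2 (hiso v)
  obtain ⟨d, hd⟩ := Nat.exists_eq_add_of_lt hlt
  obtain ⟨g, hg, hadj⟩ := exists_injective_neighbor_color G (d + 2) hpos (by nlinarith)
  obtain ⟨m, hm, hcov⟩ := exists_matchings_covering G (by lia) g hg hadj
  have key := one_div_le_pR_of_cover Finset.univ (coveredSets G) Finset.univ_nonempty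
    (by lia : 0 < d + 2) (fun i => Finset.univ.filter (fun v => ∃ e ∈ m i, v ∈ e))
    (fun i => Finset.mem_image_of_mem _ (hm i)) (fun v _ => by simpa using hcov v)
  convert key using 2
  rw [hd]
  push_cast
  ring
end
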